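/- arXiv:1901.06866 — 2 statements merged into one kernel-verified Lean document; each statement's English description precedes it below -/
import Mathlib

section
/- Let 𝒫 be a Beurling generalized prime system and ρ > 0. Suppose the sets {θ ∈ ℝ : ψ_𝒫(x) − x = O(x^θ)} and {θ ∈ ℝ : N_𝒫(x) − ρx = O(x^θ)} are nonempty with infima α and β satisfying α < β < 1. Then the set {θ ∈ ℝ : M_𝒫(x) = O(x^θ)} is nonempty and its infimum γ equals β. -/
open Filter Asymptotics

/-- ψ_𝒫(x): sum of log pᵢ over pairs (i,k) with k ≥ 1 and pᵢ^k ≤ x. -/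
noncomputable def psiP (p : ℕ → ℝ) (x : ℝ) : ℝ :=
  ∑ᶠ ik ∈ {ik : ℕ × ℕ | 1 ≤ ik.2 ∧ p ik.1 ^ ik.2 ≤ x}, Real.log (p ik.1)

/-- N_𝒫(x): number of finitely supported e : ℕ → ℕ with ∏ pᵢ^{e i} ≤ x. -/
noncomputable def NP (p : ℕ → ℝ) (x : ℝ) : ℕ :=
  Nat.card {e : ℕ →₀ ℕ | ∏ i ∈ e.support, p i ^ e i ≤ x}

/-- M_𝒫(x): sum of (−1)^|S| over finite S ⊆ ℕ with ∏_{i∈S} pᵢ ≤ x. -/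
noncomputable def MP (p : ℕ → ℝ) (x : ℝ) : ℝ :=
  ∑ᶠ S ∈ {S : Finset ℕ | ∏ i ∈ S, p i ≤ x}, (-1 : ℝ) ^ S.card



theorem taylor_two_bound {f : ℂ → ℂ} {c z : ℂ} {r0 r R R2 B M : ℝ} (hr0 : 0 < r0) (hr : 0 < r)
    (hrR : r < R) (hr0R : r0 < R2) (hRR2 : R < R2) (K : ℕ)
    (hf : DifferentiableOn ℂ f (Metric.ball c R2))
    (hB : ∀ z ∈ Metric.sphere c r0, ‖f z‖ ≤ B) (hM : ∀ z ∈ Metric.sphere c R, ‖f z‖ ≤ M)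
    (hM0 : 0 ≤ M) (hB0 : 0 ≤ B) (hz : dist z c ≤ r) :
    ‖f z‖ ≤ B * ∑ n ∈ Finset.range K, (r / r0) ^ n + M * ((r / R) ^ K * (1 - r / R)⁻¹) := by
  have hR : 0 < R := hr.trans hrR
  have hq : r / R < 1 := (div_lt_one hR).2 hrR
  have hq0 : 0 ≤ r / R := by positivity
  have hz2 : z ∈ Metric.ball c R2 := by
    rw [Metric.mem_ball]; linarith
  have hs := Complex.hasSum_taylorSeries_on_ball hf hz2
  have hd (ρ : ℝ) (hρ0 : 0 < ρ) (hρ : ρ < R2) : DiffContOnCl ℂ f (Metric.ball c ρ) := by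
    apply DifferentiableOn.diffContOnCl
    rw [closure_ball _ hρ0.ne']
    exact hf.mono (Metric.closedBall_subset_ball hρ)
  have hterm (ρ C : ℝ) (hρ0 : 0 < ρ) (hρ : ρ < R2) (hC : ∀ z ∈ Metric.sphere c ρ, ‖f z‖ ≤ C) (n : ℕ)
      (hC0 : 0 ≤ C) :
      ‖((n.factorial : ℂ))⁻¹ • (z - c) ^ n • iteratedDeriv n f c‖ ≤ C * (r / ρ) ^ n := by
    have h1 := Complex.norm_iteratedDeriv_le_of_forall_mem_sphere_norm_le n hρ0 (hd ρ hρ0 hρ) hC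
    have hnf : (0 : ℝ) < n.factorial := by positivity
    rw [norm_smul, norm_smul, norm_inv, norm_pow, Complex.norm_natCast, ← dist_eq_norm]
    calc _ ≤ (n.factorial : ℝ)⁻¹ * (r ^ n * (n.factorial * C / ρ ^ n)) := by gcongr
      _ = _ := by rw [div_pow]; field_simp
  set t := fun n : ℕ => ((n.factorial : ℂ))⁻¹ • (z - c) ^ n • iteratedDeriv n f c with ht
  have hg : HasSum (fun n => M * (r / R) ^ K * (r / R) ^ n) (M * (r / R) ^ K * (1 - r / R)⁻¹) :=
    (hasSum_geometric_of_lt_one hq0 hq).mul_left _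
  have h2 := (hasSum_nat_add_iff' K).2 hs
  have h3 : ‖f z - ∑ i ∈ Finset.range K, t i‖ ≤ M * (r / R) ^ K * (1 - r / R)⁻¹ := by
    rw [← h2.tsum_eq]
    refine tsum_of_norm_bounded hg fun n => ?_
    refine (hterm R M hR hRR2 hM (n + K) hM0).trans (le_of_eq ?_)
    rw [pow_add]; ring
  have h4 : ‖∑ i ∈ Finset.range K, t i‖ ≤ B * ∑ n ∈ Finset.range K, (r / r0) ^ n := by
    rw [Finset.mul_sum]
    exact norm_sum_le_of_le _ fun n _ => hterm r0 B hr0 hr0R hB n hB0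
  calc ‖f z‖ = ‖(∑ i ∈ Finset.range K, t i) + (f z - ∑ i ∈ Finset.range K, t i)‖ := by
        congr 1; ring
    _ ≤ _ := norm_add_le _ _
    _ ≤ _ := by rw [← mul_assoc]; exact add_le_add h4 h3

theorem bc_centered {f : ℂ → ℂ} {c z : ℂ} {r R M : ℝ} (hM : 0 < M) (hr : 0 ≤ r) (hrR : r < R)
    (hf : DifferentiableOn ℂ f (Metric.ball c R))
    (hf₁ : ∀ w ∈ Metric.ball c R, (f w - f c).re ≤ M) (hz : dist z c ≤ r) :
    ‖f z - f c‖ ≤ 2 * M * r / (R - r) := by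
  have hR : 0 < R := by linarith
  have hmaps : Set.MapsTo (fun w : ℂ => c + w) (Metric.ball 0 R) (Metric.ball c R) := by
    intro w hw
    simpa [dist_eq_norm] using hw
  have hzc : ‖z - c‖ ≤ r := by rwa [← dist_eq_norm]
  have h := Complex.borelCaratheodory_zero (f := fun w => f (c + w) - f c) (z := z - c) hM
    ((hf.comp (by fun_prop) hmaps).sub_const _) (fun w hw => hf₁ _ (hmaps hw)) hR
    (by simpa using hzc.trans_lt hrR) (by simp)
  simp only [add_sub_cancel] at h
  refine h.trans ?_
  have : 0 < R - r := by linarith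
  gcongr

theorem littlewood {δ δ' : ℝ} (hδ : 0 < δ) (hδδ : δ < δ') (hδ2 : δ' < 2) {L : ℂ → ℂ}
    (hL : DifferentiableOn ℂ L {s | δ < s.re}) {C B : ℝ}
    (hC : ∀ s : ℂ, δ < s.re → s.re < 6 → 1 ≤ |s.im| → (L s).re ≤ C * (1 + Real.log (1 + |s.im|)))
    (hB : ∀ s : ℂ, 2 ≤ s.re → s.re ≤ 4 → |(L s).re| ≤ B) {ε : ℝ} (hε : 0 < ε) :
    ∃ C', ∀ s : ℂ, δ' ≤ s.re → s.re ≤ 2 → |(L s).re| ≤ ε * Real.log (1 + |s.im|) + C' := by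
  wlog hCpos : 0 < C generalizing C
  · refine this (C := 1) (fun s h1 h2 h3 => (hC s h1 h2 h3).trans ?_) one_pos
    have : 0 ≤ Real.log (1 + |s.im|) := Real.log_nonneg (by linarith [abs_nonneg s.im])
    nlinarith
  have hB0 : 0 ≤ B := (abs_nonneg _).trans (hB 3 (by norm_num) (by norm_num))
  -- compact part
  obtain ⟨C2, hC2⟩ : ∃ C2, ∀ s : ℂ, δ' ≤ s.re → s.re ≤ 2 → |s.im| ≤ 4 → |(L s).re| ≤ C2 := by
    have hcomp : IsCompact (Set.Icc δ' 2 ×ℂ Set.Icc (-4) 4) := isCompact_Icc.reProdIm isCompact_Icc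
    have hcont : ContinuousOn L (Set.Icc δ' 2 ×ℂ Set.Icc (-4) 4) := hL.continuousOn.mono (by
      intro s hs
      rw [Complex.mem_reProdIm] at hs
      exact lt_of_lt_of_le hδδ hs.1.1)
    obtain ⟨C2, hC2⟩ := hcomp.exists_bound_of_continuousOn hcont
    refine ⟨C2, fun s h1 h2 h3 => (Complex.abs_re_le_norm _).trans (hC2 s ?_)⟩
    rw [Complex.mem_reProdIm]
    exact ⟨⟨h1, h2⟩, abs_le.1 h3⟩
  set R3 := 3 - δ with hR3
  set R2 := 3 - (δ + δ') / 2 with hR2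
  set r := 3 - δ' with hr
  have hr1 : 1 < r := by linarith
  have hrR2 : r < R2 := by linarith
  have hR23 : R2 < R3 := by linarith
  set q := r / R2 with hq
  have hq1 : q < 1 := (div_lt_one (by linarith)).2 hrR2
  have hq0 : 0 ≤ q := div_nonneg (by linarith) (by linarith)
  set κ := 2 * R2 / (R3 - R2) with hκ
  have hκ0 : 0 ≤ κ := div_nonneg (by linarith) (by linarith)
  obtain ⟨K, hK⟩ : ∃ K : ℕ, κ * C * (q ^ K * (1 - q)⁻¹) ≤ ε := by
    have h1 : Tendsto (fun K : ℕ => κ * C * (q ^ K * (1 - q)⁻¹)) atTop (nhds (κ * C * (0 * (1 - q)⁻¹))) :=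
      ((tendsto_pow_atTop_nhds_zero_of_lt_one hq0 hq1).mul_const _).const_mul _
    rw [zero_mul, mul_zero] at h1
    obtain ⟨K, hK⟩ := (h1.eventually (gt_mem_nhds hε)).exists
    exact ⟨K, hK.le⟩
  set w := q ^ K * (1 - q)⁻¹ with hw
  have hw0 : 0 ≤ w := mul_nonneg (by positivity) (inv_nonneg.2 (by linarith))
  set B1 := 2 * B + 1 with hB1
  refine ⟨max C2 (B + 2 * B1 * ∑ n ∈ Finset.range K, (r / (1/2)) ^ n + κ * (3 * C + B) * w), ?_⟩
  intro s hs1 hs2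
  have hlog : 0 ≤ Real.log (1 + |s.im|) := Real.log_nonneg (by linarith [abs_nonneg s.im])
  set lam := Real.log (1 + |s.im|) with hlam
  by_cases ht : |s.im| ≤ 4
  · have := hC2 s hs1 hs2 ht
    have h2 := le_max_left C2
      (B + 2 * B1 * ∑ n ∈ Finset.range K, (r / (1/2)) ^ n + κ * (3 * C + B) * w)
    have : 0 ≤ ε * lam := by positivity
    linarith
  push Not at ht
  set c : ℂ := ⟨3, s.im⟩ with hc
  have hball : ∀ ρ, ∀ w ∈ Metric.ball c ρ, |w.re - 3| < ρ ∧ |w.im - s.im| < ρ := by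
    intro ρ w hw
    rw [Metric.mem_ball, dist_eq_norm] at hw
    exact ⟨(Complex.abs_re_le_norm (w - c)).trans_lt hw, (Complex.abs_im_le_norm (w - c)).trans_lt hw⟩
  have hdist : dist s c ≤ r := by
    have : s - c = ((s.re - 3 : ℝ) : ℂ) := by
      apply Complex.ext <;> simp [hc]
    rw [dist_eq_norm, this, Complex.norm_real, Real.norm_eq_abs, abs_le]
    constructor <;> linarith
  have hcB : |(L c).re| ≤ B := hB c (by norm_num [hc]) (by norm_num [hc])
  have hdiff : DifferentiableOn ℂ L (Metric.ball c R3) := hL.mono fun w hw => by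
    have := (abs_lt.1 (hball _ w hw).1).1
    show δ < w.re
    linarith
  set M1 := C * (3 + lam) + B with hM1
  have hM1pos : 0 < M1 := by positivity
  have hRe : ∀ w ∈ Metric.ball c R3, (L w - L c).re ≤ M1 := by
    intro w hw
    obtain ⟨h1, h2⟩ := hball _ w hw
    rw [abs_lt] at h1
    have h3 : |w.im| ≤ |s.im| + 3 := by
      have := abs_sub_abs_le_abs_sub w.im s.im
      linarith
    have h4 : |s.im| - 3 ≤ |w.im| := by
      have := abs_sub_abs_le_abs_sub s.im w.im
      rw [abs_sub_comm] at this
      linarith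
    have h5 := hC w (by linarith) (by linarith) (by linarith)
    have h6 : Real.log (1 + |w.im|) ≤ 2 + lam := by
      have h7 : 1 + |w.im| ≤ Real.exp 2 * (1 + |s.im|) := by
        have : (3:ℝ) ≤ Real.exp 2 := by linarith [Real.add_one_le_exp 2]
        nlinarith [abs_nonneg s.im]
      calc Real.log (1 + |w.im|) ≤ Real.log (Real.exp 2 * (1 + |s.im|)) :=
            Real.log_le_log (by positivity) h7
        _ = 2 + lam := by rw [Real.log_mul (by positivity) (by positivity), Real.log_exp]
    rw [Complex.sub_re]
    have h8 := (abs_le.1 hcB).1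
    nlinarith
  have hbig : ∀ z ∈ Metric.sphere c R2, ‖L z - L c‖ ≤ κ * M1 := by
    intro z hz
    refine (bc_centered hM1pos (by linarith) hR23 hdiff hRe (le_of_eq hz)).trans (le_of_eq ?_)
    rw [hκ]; ring
  have hsmall : ∀ z ∈ Metric.sphere c (1/2), ‖L z - L c‖ ≤ 2 * B1 := by
    intro z hz
    refine (bc_centered (R := 1) (M := B1) (by positivity) (by norm_num) (by norm_num)
      (hdiff.mono (Metric.ball_subset_ball (by linarith))) ?_ (le_of_eq hz)).trans (le_of_eq ?_)
    · intro w hw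
      have h1 := abs_lt.1 (hball _ w hw).1
      have h2 := abs_le.1 (hB w (by linarith) (by linarith))
      have h3 := abs_le.1 hcB
      rw [Complex.sub_re]
      linarith
    · norm_num
  have hfin := taylor_two_bound (f := fun z => L z - L c) (z := s) (r0 := 1/2) (r := r) (R := R2) (R2 := R3)
    (by norm_num) (by linarith) hrR2 (by linarith) hR23 K (hdiff.sub_const _) hsmall hbig (by positivity)
    (by positivity) hdist
  have h1 : |(L s).re| ≤ B + ‖L s - L c‖ := by
    have h2 := Complex.abs_re_le_norm (L s - L c)
    rw [Complex.sub_re] at h2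
    have := abs_sub_abs_le_abs_sub (L s).re (L c).re
    linarith
  have h2 : κ * M1 * w ≤ ε * lam + κ * (3 * C + B) * w := by
    have : κ * M1 * w = (κ * C * w) * lam + κ * (3 * C + B) * w := by rw [hM1]; ring
    rw [this]
    gcongr
  have h3 := le_max_right C2 (B + 2 * B1 * ∑ n ∈ Finset.range K, (r / (1/2)) ^ n + κ * (3 * C + B) * w)
  linarith


theorem vert_integrable {Φ : ℂ → ℂ} {a0 a b C κ : ℝ} (ha : a0 < a) (hab : a ≤ b)
    (hΦ : DifferentiableOn ℂ Φ {s | a0 < s.re}) (hκ : 1 < κ)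
    (hb : ∀ s : ℂ, a ≤ s.re → s.re ≤ b → ‖Φ s‖ ≤ C * (1 + |s.im|) ^ (-κ)) {c : ℝ} (hac : a ≤ c)
    (hcb : c ≤ b) :
    MeasureTheory.Integrable (fun y : ℝ => Φ (c + y * Complex.I)) := by
  have h1 : MeasureTheory.Integrable (fun y : ℝ => C * (1 + ‖y‖) ^ (-κ)) :=
    (integrable_one_add_norm (by simpa using hκ)).const_mul _
  refine h1.mono' ?_ (Eventually.of_forall fun y => ?_)
  · refine Continuous.aestronglyMeasurable ?_
    refine hΦ.continuousOn.comp_continuous (by fun_prop) fun y => ?_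
    simp; linarith
  · simpa using hb (c + y * Complex.I) (by simpa using hac) (by simpa using hcb)

theorem shift {Φ : ℂ → ℂ} {a0 a b C κ : ℝ} (ha : a0 < a) (hab : a ≤ b)
    (hΦ : DifferentiableOn ℂ Φ {s | a0 < s.re}) (hκ : 1 < κ)
    (hb : ∀ s : ℂ, a ≤ s.re → s.re ≤ b → ‖Φ s‖ ≤ C * (1 + |s.im|) ^ (-κ)) :
    ∫ y : ℝ, Φ (a + y * Complex.I) = ∫ y : ℝ, Φ (b + y * Complex.I) := by
  have hA := vert_integrable ha hab hΦ hκ hb le_rfl hab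
  have hB := vert_integrable ha hab hΦ hκ hb hab le_rfl
  have tA := MeasureTheory.intervalIntegral_tendsto_integral hA tendsto_neg_atTop_atBot tendsto_id
  have tB := MeasureTheory.intervalIntegral_tendsto_integral hB tendsto_neg_atTop_atBot tendsto_id
  have hz : Tendsto (fun T : ℝ => C * (1 + |T|) ^ (-κ) * |b - a|) atTop (nhds 0) := by
    have : Tendsto (fun T : ℝ => (1 + |T|)) atTop atTop :=
      tendsto_atTop_add_const_left _ _ tendsto_abs_atTop_atTop
    have h2 := (tendsto_rpow_neg_atTop (y := κ) (by linarith)).comp this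
    simpa using (h2.const_mul C).mul_const |b - a|
  have tH (e : ℝ) (he : |e| = 1) :
      Tendsto (fun T : ℝ => ∫ x in a..b, Φ (x + (e * T : ℝ) * Complex.I)) atTop (nhds 0) := by
    refine squeeze_zero_norm (fun T => ?_) hz
    refine intervalIntegral.norm_integral_le_of_norm_le_const fun x hx => ?_
    rw [Set.uIoc_of_le hab] at hx
    have := hb (x + (e * T : ℝ) * Complex.I) (by simpa using hx.1.le) (by simpa using hx.2)
    simpa [abs_mul, he] using this
  have key (T : ℝ) := Complex.integral_boundary_rect_eq_zero_of_differentiableOn Φ ⟨a, -T⟩ ⟨b, T⟩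
    (hΦ.mono (by
      intro s hs
      rw [Complex.mem_reProdIm] at hs
      have := hs.1
      rw [Set.uIcc_of_le hab] at this
      exact lt_of_lt_of_le ha this.1))
  have lim := (((tH (-1) (by simp)).sub (tH 1 (by simp))).add (tB.const_smul Complex.I)).sub
    (tA.const_smul Complex.I)
  have lim0 : Tendsto (fun T : ℝ => (0 : ℂ)) atTop (nhds 0) := tendsto_const_nhds
  have := tendsto_nhds_unique (lim.congr (fun T => by simpa using key T)) lim0
  simp only [sub_zero, zero_add, smul_eq_mul] at this
  have h3 : Complex.I * ((∫ y : ℝ, Φ (b + y * Complex.I)) - ∫ y : ℝ, Φ (a + y * Complex.I)) = 0 := by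
    rw [mul_sub]; exact this
  have h4 := (mul_eq_zero.1 h3).resolve_left Complex.I_ne_zero
  exact (sub_eq_zero.1 h4).symm


theorem isBigO_bot_of_zero {f : ℝ → ℂ} (h0 : ∀ x < 1, f x = 0) (g : ℝ → ℝ) :
    f =O[nhdsWithin 0 (Set.Ioi 0)] g := by
  refine IsBigO.of_bound 0 ?_
  filter_upwards [mem_nhdsWithin_of_mem_nhds (Iio_mem_nhds (zero_lt_one (α := ℝ)))] with x hx
  simp [h0 x hx]

theorem mellinConv_neg {f : ℝ → ℂ} {θ : ℝ} {s : ℂ} (hf : MeasureTheory.LocallyIntegrable f)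
    (h0 : ∀ x < 1, f x = 0) (hO : f =O[atTop] fun x : ℝ => x ^ θ) (hs : θ < s.re) :
    MellinConvergent f (-s) :=
  mellinConvergent_of_isBigO_rpow (a := -θ) (b := -s.re - 1) (hf.locallyIntegrableOn _) (by simpa using hO)
    (by simpa using hs) (isBigO_bot_of_zero h0 _) (by simp)

theorem mellin_neg_diffAt {f : ℝ → ℂ} {θ : ℝ} {s : ℂ} (hf : MeasureTheory.LocallyIntegrable f)
    (h0 : ∀ x < 1, f x = 0) (hO : f =O[atTop] fun x : ℝ => x ^ θ) (hs : θ < s.re) :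
    DifferentiableAt ℂ (fun s => mellin f (-s)) s := by
  have := mellin_differentiableAt_of_isBigO_rpow (f := f) (s := -s) (a := -θ) (b := -s.re - 1)
    (hf.locallyIntegrableOn _) (by simpa using hO)
    (by simpa using hs) (isBigO_bot_of_zero h0 _) (by simp)
  exact DifferentiableAt.comp (g := mellin f) s this (by fun_prop)

theorem norm_mellin_neg_le {f : ℝ → ℂ} {θ σ : ℝ} (hf : MeasureTheory.LocallyIntegrable f)
    (h0 : ∀ x < 1, f x = 0) (hO : f =O[atTop] fun x : ℝ => x ^ θ) (hs : θ < σ) :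
    ∃ C, 0 ≤ C ∧ ∀ s : ℂ, σ ≤ s.re → ‖mellin f (-s)‖ ≤ C := by
  have h1 := mellinConv_neg (s := σ) hf h0 hO (by simpa using hs)
  refine ⟨∫ x in Set.Ioi (0:ℝ), ‖(x : ℂ) ^ (-(σ:ℂ) - 1) • f x‖,
    MeasureTheory.integral_nonneg fun x => norm_nonneg _, fun s hs => ?_⟩
  refine (MeasureTheory.norm_integral_le_integral_norm _).trans ?_
  refine MeasureTheory.setIntegral_mono_on (mellinConv_neg (s := s) hf h0 hO (by linarith)).norm h1.norm
    measurableSet_Ioi fun x hx => ?_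
  have hx0 : (0:ℝ) < x := hx
  by_cases hx1 : x < 1
  · simp [h0 x hx1]
  rw [norm_smul, norm_smul, Complex.norm_cpow_eq_rpow_re_of_pos hx0, Complex.norm_cpow_eq_rpow_re_of_pos hx0]
  refine mul_le_mul_of_nonneg_right ?_ (norm_nonneg _)
  refine Real.rpow_le_rpow_of_exponent_le (by linarith) ?_
  simpa using hs

theorem abs_le_all {A : ℝ → ℝ} {C0 : ℝ} (hA0 : ∀ x < 1, A x = 0)
    (hA : ∀ x, 1 ≤ x → |A x| ≤ C0 * x) (x : ℝ) : |A x| ≤ C0 * |x| := by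
  by_cases h : x < 1
  · rw [hA0 x h, abs_zero]
    have := (abs_nonneg _).trans (hA 1 le_rfl)
    have : 0 ≤ C0 := by linarith
    positivity
  · rw [abs_of_nonneg (by linarith : 0 ≤ x)]; exact hA x (by linarith)

theorem locInt_of_bound {A : ℝ → ℝ} {C0 : ℝ} (hm : Measurable A) (hA0 : ∀ x < 1, A x = 0)
    (hA : ∀ x, 1 ≤ x → |A x| ≤ C0 * x) : MeasureTheory.LocallyIntegrable A := by
  have h1 : MeasureTheory.LocallyIntegrable (fun x : ℝ => C0 * |x|) :=
    (by fun_prop : Continuous fun x : ℝ => C0 * |x|).locallyIntegrable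
  refine h1.mono hm.aestronglyMeasurable (Eventually.of_forall fun x => ?_)
  rw [Real.norm_eq_abs, Real.norm_eq_abs]
  exact (abs_le_all hA0 hA x).trans (le_abs_self _)

theorem isBigO_of_bound {A : ℝ → ℝ} {C0 : ℝ}
    (hA : ∀ x, 1 ≤ x → |A x| ≤ C0 * x) : (fun x => (A x : ℂ)) =O[atTop] fun x : ℝ => x ^ (1:ℝ) := by
  refine IsBigO.of_bound C0 ?_
  filter_upwards [eventually_ge_atTop 1] with x hx
  rw [Complex.norm_real, Real.norm_eq_abs, Real.rpow_one, Real.norm_eq_abs, abs_of_nonneg (by linarith : 0 ≤ x)]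
  exact hA x hx

theorem locInt_complex {A : ℝ → ℝ} (h : MeasureTheory.LocallyIntegrable A) :
    MeasureTheory.LocallyIntegrable (fun x => (A x : ℂ)) := by
  intro x
  obtain ⟨u, hu, h2⟩ := h x
  exact ⟨u, hu, MeasureTheory.Integrable.ofReal h2⟩

theorem mellin_prim {A : ℝ → ℝ} {C0 : ℝ} (hm : Measurable A) (hA0 : ∀ x < 1, A x = 0)
    (hA : ∀ x, 1 ≤ x → |A x| ≤ C0 * x) {s : ℂ} (hs : 1 < s.re) :
    mellin (fun x => ((∫ y in (0:ℝ)..x, A y : ℝ) : ℂ)) (-(s+1)) =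
      mellin (fun x => (A x : ℂ)) (-s) / (s + 1) := by
  have hs1 : s + 1 ≠ 0 := by
    intro h
    have := congrArg Complex.re h
    simp at this
    linarith
  have hconv := mellinConv_neg (s := s) (locInt_complex (locInt_of_bound hm hA0 hA))
    (fun x hx => by simp [hA0 x hx]) (isBigO_of_bound hA) hs
  set μ := MeasureTheory.volume.restrict (Set.Ioi (0:ℝ)) with hμ
  set F : ℝ → ℝ → ℂ := fun x y => (Set.Ioi y).indicator (fun x : ℝ => (x : ℂ) ^ (-(s+1) - 1)) x * A y with hF
  have hFm : Measurable (Function.uncurry F) := by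
    have h1 : Measurable (fun z : ℝ × ℝ => (z.1 : ℂ) ^ (-(s+1) - 1)) := by fun_prop
    have h2 : Function.uncurry F = fun z => ({z : ℝ × ℝ | z.2 < z.1}).indicator
        (fun z : ℝ × ℝ => (z.1 : ℂ) ^ (-(s+1) - 1)) z * A z.2 := by
      ext ⟨x, y⟩
      simp [hF, Set.indicator_apply]
    rw [h2]
    exact (h1.indicator (measurableSet_lt measurable_snd measurable_fst)).mul (by fun_prop)
  have hre : (-(s+1) - 1).re < -1 := by simp; linarith
  have hIx : ∀ y : ℝ, 0 < y → MeasureTheory.Integrable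
      ((Set.Ioi y).indicator (fun x : ℝ => (x : ℂ) ^ (-(s+1) - 1))) μ := by
    intro y hy
    rw [MeasureTheory.integrable_indicator_iff measurableSet_Ioi, MeasureTheory.IntegrableOn, hμ,
      MeasureTheory.Measure.restrict_restrict measurableSet_Ioi, Set.inter_eq_left.2 (Set.Ioi_subset_Ioi hy.le)]
    exact integrableOn_Ioi_cpow_of_lt hre hy
  have hval : ∀ y : ℝ, 0 < y → ∫ x, (Set.Ioi y).indicator (fun x : ℝ => (x : ℂ) ^ (-(s+1) - 1)) x ∂μ
      = (y : ℂ) ^ (-s - 1) / (s + 1) := by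
    intro y hy
    rw [MeasureTheory.integral_indicator measurableSet_Ioi, hμ,
      MeasureTheory.Measure.restrict_restrict measurableSet_Ioi, Set.inter_eq_left.2 (Set.Ioi_subset_Ioi hy.le),
      integral_Ioi_cpow_of_lt hre hy]
    rw [show -(s+1) - 1 + 1 = -(s+1) by ring, neg_div_neg_eq, show -(s+1) = -s - 1 by ring]
  have hvaln : ∀ y : ℝ, 0 < y → ∫ x, ‖(Set.Ioi y).indicator (fun x : ℝ => (x : ℂ) ^ (-(s+1) - 1)) x‖ ∂μ
      = y ^ (-s.re - 1) / (s.re + 1) := by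
    intro y hy
    simp_rw [norm_indicator_eq_indicator_norm]
    rw [MeasureTheory.integral_indicator measurableSet_Ioi, hμ,
      MeasureTheory.Measure.restrict_restrict measurableSet_Ioi, Set.inter_eq_left.2 (Set.Ioi_subset_Ioi hy.le)]
    have : ∫ x in Set.Ioi y, ‖(x : ℂ) ^ (-(s+1) - 1)‖ = ∫ x in Set.Ioi y, x ^ (-(s.re + 1) - 1) := by
      refine MeasureTheory.setIntegral_congr_fun measurableSet_Ioi fun x hx => ?_
      have hx0 : 0 < x := hy.trans hx
      simp [Complex.norm_cpow_eq_rpow_re_of_pos hx0]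
    rw [this, integral_Ioi_rpow_of_lt (by linarith) hy]
    rw [show -(s.re+1) - 1 + 1 = -(s.re+1) by ring, neg_div_neg_eq, show -(s.re+1) = -s.re - 1 by ring]
  have hIntF : MeasureTheory.Integrable (Function.uncurry F) (μ.prod μ) := by
    rw [MeasureTheory.integrable_prod_iff' hFm.aestronglyMeasurable]
    constructor
    · refine (MeasureTheory.ae_restrict_iff' measurableSet_Ioi).2 (Eventually.of_forall fun y hy => ?_)
      exact (hIx y hy).mul_const (A y : ℂ)
    · have h1 : MeasureTheory.Integrable (fun y : ℝ => ‖(y : ℂ) ^ (-s - 1) • (A y : ℂ)‖ / (s.re + 1)) μ :=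
        hconv.norm.div_const _
      refine h1.congr ?_
      refine (MeasureTheory.ae_restrict_iff' measurableSet_Ioi).2 (Eventually.of_forall fun y hy => ?_)
      have hy0 : 0 < y := hy
      simp only [Function.uncurry, hF, norm_mul, norm_smul]
      rw [MeasureTheory.integral_mul_const, hvaln y hy, Complex.norm_cpow_eq_rpow_re_of_pos hy0]
      simp
      ring
  have hswap := MeasureTheory.integral_integral_swap hIntF
  have hL : mellin (fun x => ((∫ y in (0:ℝ)..x, A y : ℝ) : ℂ)) (-(s+1)) = ∫ x, ∫ y, F x y ∂μ ∂μ := by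
    refine MeasureTheory.setIntegral_congr_fun measurableSet_Ioi fun x hx => ?_
    have hx0 : 0 < x := hx
    have h1 : ∀ y, F x y = (Set.Iio x).indicator (fun y => (x : ℂ) ^ (-(s+1) - 1) * A y) y := by
      intro y
      simp only [hF, Set.indicator_apply, Set.mem_Ioi, Set.mem_Iio]
      split_ifs <;> simp
    simp_rw [h1]
    rw [MeasureTheory.integral_indicator measurableSet_Iio, hμ,
      MeasureTheory.Measure.restrict_restrict measurableSet_Iio, MeasureTheory.integral_const_mul,
      intervalIntegral.integral_of_le hx0.le, MeasureTheory.integral_Ioc_eq_integral_Ioo, smul_eq_mul]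
    congr 1
    rw [show Set.Iio x ∩ Set.Ioi 0 = Set.Ioo 0 x by ext; simp [and_comm]]
    exact integral_complex_ofReal.symm
  rw [hL, hswap, mellin, ← MeasureTheory.integral_div]
  refine MeasureTheory.setIntegral_congr_fun measurableSet_Ioi fun y hy => ?_
  simp only [hF]
  rw [MeasureTheory.integral_mul_const, hval y hy, smul_eq_mul]
  ring



theorem locInt_ii {f : ℝ → ℝ} (h : MeasureTheory.LocallyIntegrable f) (a b : ℝ) :
    IntervalIntegrable f MeasureTheory.volume a b :=
  (h.integrableOn_isCompact isCompact_uIcc).intervalIntegrable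

theorem perron_inv {A : ℝ → ℝ} {C0 a0 a ε C : ℝ} {G : ℂ → ℂ} (hm : Measurable A)
    (hA0 : ∀ x < 1, A x = 0) (hA : ∀ x, 1 ≤ x → |A x| ≤ C0 * x)
    (ha0 : 0 < a0) (ha : a0 < a) (ha2 : a ≤ 2) (hε1 : ε < 1)
    (hG : DifferentiableOn ℂ G {s | a0 < s.re})
    (hAG : ∀ s : ℂ, 1 < s.re → mellin (fun x => (A x : ℂ)) (-s) = G s)
    (hb : ∀ s : ℂ, a ≤ s.re → s.re ≤ 2 → ‖G s‖ ≤ C * (1 + |s.im|) ^ (ε - 1)) {x : ℝ} (hx : 0 < x) :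
    MeasureTheory.Integrable (fun y : ℝ =>
      (x : ℂ) ^ ((a + y * Complex.I : ℂ) + 1) * (G (a + y * Complex.I) / (a + y * Complex.I + 1))) ∧
    ((∫ y in (0:ℝ)..x, A y : ℝ) : ℂ) = (1 / (2 * Real.pi) : ℝ) * ∫ y : ℝ,
      (x : ℂ) ^ ((a + y * Complex.I : ℂ) + 1) * (G (a + y * Complex.I) / (a + y * Complex.I + 1)) := by
  have hC0 : 0 ≤ C0 := by
    have := (abs_nonneg _).trans (hA 1 le_rfl)
    linarith
  have hC : 0 ≤ C := by
    have := (norm_nonneg _).trans (hb a (by simp) (by simpa using ha2))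
    simpa using this
  set R1 : ℝ → ℂ := fun x => ((∫ y in (0:ℝ)..x, A y : ℝ) : ℂ) with hR1
  have hloc := locInt_of_bound hm hA0 hA
  have hcont : Continuous R1 :=
    Complex.continuous_ofReal.comp
      (intervalIntegral.continuous_primitive (fun a b => locInt_ii hloc a b) 0)
  have hR0 : ∀ x < 1, R1 x = 0 := by
    intro x hx
    simp only [hR1, Complex.ofReal_eq_zero]
    refine intervalIntegral.integral_zero_ae (Eventually.of_forall fun y hy => hA0 y ?_)
    have := hy.2
    refine lt_of_le_of_lt this (max_lt one_pos hx)
  have hRO : R1 =O[atTop] fun x : ℝ => x ^ (2:ℝ) := by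
    refine IsBigO.of_bound C0 ?_
    filter_upwards [eventually_ge_atTop 1] with x hx
    simp only [hR1]
    rw [Complex.norm_real, Real.rpow_two, Real.norm_eq_abs (x^2), abs_of_nonneg (by positivity : 0 ≤ x ^ 2)]
    refine (intervalIntegral.norm_integral_le_of_norm_le_const (C := C0 * x) fun y hy => ?_).trans (le_of_eq ?_)
    · rw [Set.uIoc_of_le (by linarith)] at hy
      refine (abs_le_all hA0 hA y).trans ?_
      rw [abs_of_pos hy.1]
      have := hy.2
      gcongr
    · rw [sub_zero, abs_of_nonneg (by linarith)]; ring
  set Φ : ℂ → ℂ := fun s => (x : ℂ) ^ (s + 1) * (G s / (s + 1)) with hΦ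
  have hne : ∀ s : ℂ, 0 < s.re → s + 1 ≠ 0 := by
    intro s hs h
    have := congrArg Complex.re h
    simp at this
    linarith
  have hx0 : (x : ℂ) ≠ 0 := by exact_mod_cast hx.ne'
  have hΦd : DifferentiableOn ℂ Φ {s | a0 < s.re} := by
    intro s hs
    have hs' : a0 < s.re := hs
    refine DifferentiableWithinAt.mul ?_ ((hG s hs).div (by fun_prop) (hne s (by linarith)))
    refine DifferentiableAt.differentiableWithinAt ?_
    exact DifferentiableAt.const_cpow (by fun_prop) (Or.inl hx0)
  have hnorm : ∀ s : ℂ, 0 < s.re → (1 + |s.im|) / 2 ≤ ‖s + 1‖ := by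
    intro s hs
    have h1 := Complex.abs_re_le_norm (s + 1)
    have h2 := Complex.abs_im_le_norm (s + 1)
    simp only [Complex.add_re, Complex.one_re, Complex.add_im, Complex.one_im, add_zero] at h1 h2
    rw [abs_of_pos (by linarith)] at h1
    linarith
  have hΦb : ∀ s : ℂ, a ≤ s.re → s.re ≤ 2 →
      ‖G s / (s + 1)‖ ≤ (2 * C) * (1 + |s.im|) ^ (-(2 - ε)) := by
    intro s h1 h2
    have hp : 0 < 1 + |s.im| := by positivity
    rw [norm_div]
    calc ‖G s‖ / ‖s + 1‖ ≤ (C * (1 + |s.im|) ^ (ε - 1)) / ((1 + |s.im|) / 2) := by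
          gcongr
          · exact hb s h1 h2
          · exact hnorm s (by linarith)
      _ = (2 * C) * ((1 + |s.im|) ^ (ε - 1) / (1 + |s.im|)) := by field_simp
      _ = _ := by rw [← Real.rpow_sub_one hp.ne']; congr 2; ring
  have hΦb2 : ∀ s : ℂ, a ≤ s.re → s.re ≤ 2 →
      ‖Φ s‖ ≤ ((max 1 x) ^ (3:ℝ) * (2 * C)) * (1 + |s.im|) ^ (-(2 - ε)) := by
    intro s h1 h2
    simp only [hΦ]
    rw [norm_mul, mul_assoc]
    gcongr
    · rw [Complex.norm_cpow_eq_rpow_re_of_pos hx]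
      calc x ^ (s + 1).re ≤ (max 1 x) ^ (s + 1).re := by
            refine Real.rpow_le_rpow hx.le (le_max_right _ _) ?_
            simp; linarith
        _ ≤ _ := by
            refine Real.rpow_le_rpow_of_exponent_le (le_max_left _ _) ?_
            simp; linarith
    · exact hΦb s h1 h2
  have hκ : 1 < 2 - ε := by linarith
  refine ⟨vert_integrable ha ha2 hΦd hκ hΦb2 le_rfl ha2, ?_⟩
  have hsh := shift ha ha2 hΦd hκ hΦb2
  have hGd : DifferentiableOn ℂ (fun s => G s / (s + 1)) {s | a0 < s.re} := by
    intro s hs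
    have hs' : a0 < s.re := hs
    exact (hG s hs).div (by fun_prop) (hne s (by linarith))
  have hmel : ∀ y : ℝ, mellin R1 (((-3 : ℝ) : ℂ) + y * Complex.I) =
      G ((2:ℝ) + (-y : ℝ) * Complex.I) / ((2:ℝ) + (-y : ℝ) * Complex.I + 1) := by
    intro y
    have h1 := mellin_prim hm hA0 hA (s := (2:ℝ) + (-y : ℝ) * Complex.I) (by simp)
    rw [hAG _ (by simp)] at h1
    rw [← h1]
    congr 1
    push_cast
    ring
  have hinv := mellinInv_mellin_eq (-3) R1 hx ?_ ?_ hcont.continuousAt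
  · show R1 x = _ * ∫ y : ℝ, Φ (a + y * Complex.I)
    rw [← hinv, mellinInv, hsh, ← MeasureTheory.integral_neg_eq_self]
    congr 1
    refine MeasureTheory.integral_congr_ae (Eventually.of_forall fun y => ?_)
    show (x : ℂ) ^ (-(((-3 : ℝ) : ℂ) + (-y : ℝ) * Complex.I)) • mellin R1 (((-3 : ℝ) : ℂ) + (-y : ℝ) * Complex.I) =
      Φ ((2:ℝ) + (y : ℝ) * Complex.I)
    rw [hmel, neg_neg]
    simp only [hΦ, smul_eq_mul]
    congr 2
    push_cast
    ring
  · have := mellinConv_neg (s := (3 : ℂ)) hcont.locallyIntegrable hR0 hRO (by norm_num)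
    simpa using this
  · have h1 := (vert_integrable ha ha2 hGd hκ hΦb ha2 le_rfl).comp_neg
    refine h1.congr (Eventually.of_forall fun y => ?_)
    exact (hmel y).symm

theorem perron {A : ℝ → ℝ} {C0 a0 a ε η C : ℝ} {G : ℂ → ℂ} (hm : Measurable A)
    (hA0 : ∀ x < 1, A x = 0) (hA : ∀ x, 1 ≤ x → |A x| ≤ C0 * x)
    (ha0 : 0 < a0) (ha : a0 < a) (ha2 : a ≤ 2) (hε : 0 < ε) (hεη : ε < η) (hη : η ≤ 1)
    (hG : DifferentiableOn ℂ G {s | a0 < s.re})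
    (hAG : ∀ s : ℂ, 1 < s.re → mellin (fun x => (A x : ℂ)) (-s) = G s)
    (hb : ∀ s : ℂ, a ≤ s.re → s.re ≤ 2 → ‖G s‖ ≤ C * (1 + |s.im|) ^ (ε - 1)) :
    (fun x : ℝ => ∫ y in x..x+1, A y) =O[atTop] fun x : ℝ => x ^ (a + η) := by
  have hC : 0 ≤ C := by
    have := (norm_nonneg _).trans (hb a (by simp) (by simpa using ha2))
    simpa using this
  have hloc := locInt_of_bound hm hA0 hA
  set J := ∫ y : ℝ, (1 + ‖y‖) ^ (-(1 + η - ε)) with hJ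
  have hJi : MeasureTheory.Integrable (fun y : ℝ => (1 + ‖y‖) ^ (-(1 + η - ε))) :=
    integrable_one_add_norm (by simp; linarith)
  refine IsBigO.of_bound (1 / (2 * Real.pi) * (4 * C * 2 ^ (a + η) * J)) ?_
  filter_upwards [eventually_ge_atTop 1] with x hx
  have hx0 : 0 < x := by linarith
  obtain ⟨i1, e1⟩ := perron_inv hm hA0 hA ha0 ha ha2 (hεη.trans_le hη) hG hAG hb hx0
  obtain ⟨i2, e2⟩ := perron_inv hm hA0 hA ha0 ha ha2 (hεη.trans_le hη) hG hAG hb (x := x + 1) (by linarith)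
  have hdiff : (∫ y in x..x+1, A y) = (∫ y in (0:ℝ)..(x+1), A y) - ∫ y in (0:ℝ)..x, A y :=
    (intervalIntegral.integral_interval_sub_left (locInt_ii hloc _ _) (locInt_ii hloc _ _)).symm
  have hkey : ((∫ y in x..x+1, A y : ℝ) : ℂ) = (1 / (2 * Real.pi) : ℝ) * ∫ y : ℝ,
      (((x + 1 : ℝ) : ℂ) ^ ((a + y * Complex.I : ℂ) + 1) * (G (a + y * Complex.I) / (a + y * Complex.I + 1))
       - (x : ℂ) ^ ((a + y * Complex.I : ℂ) + 1) * (G (a + y * Complex.I) / (a + y * Complex.I + 1))) := by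
    rw [MeasureTheory.integral_sub i2 i1, mul_sub, ← e1, ← e2, hdiff]
    push_cast
    rfl
  have hnorm : ‖∫ y in x..x+1, A y‖ = ‖((∫ y in x..x+1, A y : ℝ) : ℂ)‖ := by
    rw [Complex.norm_real]
  rw [hnorm, hkey, norm_mul, Complex.norm_real, Real.norm_eq_abs, abs_of_nonneg (by positivity), mul_assoc]
  rw [Real.norm_eq_abs, abs_of_nonneg (by positivity)]
  refine mul_le_mul_of_nonneg_left ?_ (by positivity)
  have hb2 : ∀ y : ℝ, ‖((x + 1 : ℝ) : ℂ) ^ ((a + y * Complex.I : ℂ) + 1) * (G (a + y * Complex.I) / (a + y * Complex.I + 1))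
       - (x : ℂ) ^ ((a + y * Complex.I : ℂ) + 1) * (G (a + y * Complex.I) / (a + y * Complex.I + 1))‖ ≤ 
       (4 * C * 2 ^ (a + η) * x ^ (a + η)) * (1 + ‖y‖) ^ (-(1 + η - ε)) := by
    intro y
    set s : ℂ := a + y * Complex.I with hs
    have hsre : s.re = a := by simp [hs]
    have hsim : s.im = y := by simp [hs]
    have hne : s + 1 ≠ 0 := by
      intro h
      have := congrArg Complex.re h
      simp [hsre] at this
      linarith
    set D : ℂ := (((x + 1 : ℝ) : ℂ) ^ (s + 1) - (x : ℂ) ^ (s + 1)) / (s + 1) with hD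
    have hGs := hb s (by rw [hsre]) (by rw [hsre]; exact ha2)
    rw [hsim] at hGs
    have heq : ((x + 1 : ℝ) : ℂ) ^ (s + 1) * (G s / (s + 1)) - (x : ℂ) ^ (s + 1) * (G s / (s + 1)) = D * G s := by
      rw [hD]; ring
    rw [heq, norm_mul]
    have hD1 : ‖D‖ ≤ (x + 1) ^ a := by
      have h1 : D = ∫ u in x..x+1, (u : ℂ) ^ s := by
        rw [integral_cpow (Or.inl (by rw [hsre]; linarith))]
      rw [h1]
      refine (intervalIntegral.norm_integral_le_of_norm_le_const (C := (x + 1) ^ a) fun u hu => ?_).trans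
        (le_of_eq (by simp))
      rw [Set.uIoc_of_le (by linarith)] at hu
      have hu0 : 0 < u := hx0.trans hu.1
      rw [Complex.norm_cpow_eq_rpow_re_of_pos hu0, hsre]
      exact Real.rpow_le_rpow hu0.le hu.2 (by linarith)
    have hn1 : (1 + |y|) / 2 ≤ ‖s + 1‖ := by
      have h1 := Complex.abs_re_le_norm (s + 1)
      have h2 := Complex.abs_im_le_norm (s + 1)
      simp only [Complex.add_re, Complex.one_re, Complex.add_im, Complex.one_im, add_zero, hsre, hsim] at h1 h2
      rw [abs_of_pos (by linarith)] at h1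
      linarith
    have hD2 : ‖D‖ ≤ 4 * (x + 1) ^ (a + 1) / (1 + |y|) := by
      rw [hD, norm_div]
      have h1 : ‖((x + 1 : ℝ) : ℂ) ^ (s + 1) - (x : ℂ) ^ (s + 1)‖ ≤ 2 * (x + 1) ^ (a + 1) := by
        refine (norm_sub_le _ _).trans ?_
        rw [Complex.norm_cpow_eq_rpow_re_of_pos hx0, Complex.norm_cpow_eq_rpow_re_of_pos (by linarith)]
        simp only [Complex.add_re, Complex.one_re, hsre]
        have : x ^ (a + 1) ≤ (x + 1) ^ (a + 1) := Real.rpow_le_rpow hx0.le (by linarith) (by linarith)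
        linarith
      calc _ ≤ (2 * (x + 1) ^ (a + 1)) / ((1 + |y|) / 2) := by gcongr
        _ = _ := by field_simp; ring
    have hη0 : 0 < η := hε.trans hεη
    have hx1 : 0 < x + 1 := by linarith
    have hy1 : 0 < 1 + |y| := by positivity
    have hD3 : ‖D‖ ≤ 4 * (x + 1) ^ (a + η) * (1 + |y|) ^ (-η) := by
      calc ‖D‖ = ‖D‖ ^ (1 - η) * ‖D‖ ^ η := by
            rw [← Real.rpow_add_of_nonneg (norm_nonneg _) (by linarith) hη0.le]; simp
        _ ≤ ((x + 1) ^ a) ^ (1 - η) * (4 * (x + 1) ^ (a + 1) / (1 + |y|)) ^ η := by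
            have : 0 ≤ 1 - η := by linarith
            gcongr
        _ = 4 ^ η * (((x + 1) ^ (a * (1 - η))) * (x + 1) ^ ((a + 1) * η)) * (1 + |y|) ^ (-η) := by
            rw [Real.div_rpow (by positivity) hy1.le, Real.mul_rpow (by norm_num) (by positivity),
              ← Real.rpow_mul hx1.le, ← Real.rpow_mul hx1.le, Real.rpow_neg hy1.le]
            ring
        _ = 4 ^ η * (x + 1) ^ (a + η) * (1 + |y|) ^ (-η) := by
            rw [← Real.rpow_add hx1]; congr 3; ring
        _ ≤ 4 * (x + 1) ^ (a + η) * (1 + |y|) ^ (-η) := by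
            gcongr
            calc (4:ℝ) ^ η ≤ 4 ^ (1:ℝ) := Real.rpow_le_rpow_of_exponent_le (by norm_num) hη
              _ = 4 := by simp
    have hx2 : (x + 1) ^ (a + η) ≤ 2 ^ (a + η) * x ^ (a + η) := by
      rw [← Real.mul_rpow (by norm_num) hx0.le]
      exact Real.rpow_le_rpow hx1.le (by linarith) (by linarith)
    calc ‖D‖ * ‖G s‖ ≤ (4 * (2 ^ (a + η) * x ^ (a + η)) * (1 + |y|) ^ (-η)) * (C * (1 + |y|) ^ (ε - 1)) := by
          have : ‖D‖ ≤ 4 * (2 ^ (a + η) * x ^ (a + η)) * (1 + |y|) ^ (-η) := hD3.trans (by gcongr)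
          gcongr
      _ = (4 * C * 2 ^ (a + η) * x ^ (a + η)) * ((1 + |y|) ^ (-η) * (1 + |y|) ^ (ε - 1)) := by ring
      _ = _ := by
          rw [← Real.rpow_add hy1, Real.norm_eq_abs]; congr 2; ring
  refine (MeasureTheory.norm_integral_le_of_norm_le (hJi.const_mul _) (Eventually.of_forall hb2)).trans (le_of_eq ?_)
  rw [MeasureTheory.integral_const_mul]
  ring


theorem tail_real {n σ : ℝ} (hn : 1 ≤ n) (hσ : 0 < σ) :
    MeasureTheory.IntegrableOn (fun x : ℝ => if n ≤ x then x ^ (-σ - 1) else 0) (Set.Ioi 0) ∧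
    ∫ x in Set.Ioi (0:ℝ), (if n ≤ x then x ^ (-σ - 1) else 0) = n ^ (-σ) / σ := by
  have hn0 : 0 < n := by linarith
  have h1 : (fun x : ℝ => if n ≤ x then x ^ (-σ - 1) else 0) = (Set.Ici n).indicator (fun x => x ^ (-σ - 1)) := by
    funext x; simp [Set.indicator]
  have h2 : Set.Ioi (0:ℝ) ∩ Set.Ici n = Set.Ici n := by
    ext x; simp; intro h; linarith
  have h3 := integrableOn_Ioi_rpow_of_lt (a := -σ - 1) (by linarith) hn0
  rw [h1]
  constructor
  · rw [MeasureTheory.integrableOn_indicator_iff measurableSet_Ici, Set.inter_comm, h2]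
    exact (integrableOn_Ici_iff_integrableOn_Ioi).2 h3
  · rw [MeasureTheory.setIntegral_indicator measurableSet_Ici, h2,
      MeasureTheory.integral_Ici_eq_integral_Ioi, integral_Ioi_rpow_of_lt (by linarith) hn0]
    rw [sub_add_cancel, neg_div_neg_eq]

theorem tail_cpx {n : ℝ} {s : ℂ} (hn : 1 ≤ n) (hs : 0 < s.re) :
    MeasureTheory.IntegrableOn (fun x : ℝ => if n ≤ x then (x : ℂ) ^ (-s - 1) else 0) (Set.Ioi 0) ∧
    ∫ x in Set.Ioi (0:ℝ), (if n ≤ x then (x : ℂ) ^ (-s - 1) else 0) = (n : ℂ) ^ (-s) / s := by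
  have hn0 : 0 < n := by linarith
  have h1 : (fun x : ℝ => if n ≤ x then (x : ℂ) ^ (-s - 1) else 0) = (Set.Ici n).indicator (fun x : ℝ => (x : ℂ) ^ (-s - 1)) := by
    funext x; simp [Set.indicator]
  have h2 : Set.Ioi (0:ℝ) ∩ Set.Ici n = Set.Ici n := by
    ext x; simp; intro h; linarith
  have hre : (-s - 1).re < -1 := by simp; linarith
  have h3 := integrableOn_Ioi_cpow_of_lt hre hn0
  rw [h1]
  constructor
  · rw [MeasureTheory.integrableOn_indicator_iff measurableSet_Ici, Set.inter_comm, h2]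
    exact (integrableOn_Ici_iff_integrableOn_Ioi).2 h3
  · rw [MeasureTheory.setIntegral_indicator measurableSet_Ici, h2,
      MeasureTheory.integral_Ici_eq_integral_Ioi, integral_Ioi_cpow_of_lt hre hn0]
    rw [sub_add_cancel, neg_div_neg_eq]

theorem dir_hasSum {ι : Type*} [Countable ι] {n w : ι → ℝ} {A : ℝ → ℝ} {s : ℂ}
    (hn : ∀ i, 1 ≤ n i) (hs : 0 < s.re) (hsum : Summable fun i => |w i| * n i ^ (-s.re))
    (hA : ∀ x, HasSum (fun i => if n i ≤ x then w i else 0) (A x)) :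
    HasSum (fun i => (w i : ℂ) * (n i : ℂ) ^ (-s)) (s * mellin (fun x => (A x : ℂ)) (-s)) := by
  have hs0 : s ≠ 0 := by rintro rfl; simp at hs
  set F : ι → ℝ → ℂ := fun i x => (w i : ℂ) * (if n i ≤ x then (x : ℂ) ^ (-s - 1) else 0) with hF
  have hFi : ∀ i, MeasureTheory.Integrable (F i) (MeasureTheory.volume.restrict (Set.Ioi 0)) :=
    fun i => (tail_cpx (hn i) hs).1.const_mul _
  have hFn : ∀ i, ∫ x in Set.Ioi (0:ℝ), ‖F i x‖ = |w i| * n i ^ (-s.re) / s.re := by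
    intro i
    rw [mul_div_assoc, ← (tail_real (hn i) hs).2, ← MeasureTheory.integral_const_mul]
    refine MeasureTheory.setIntegral_congr_fun measurableSet_Ioi fun x hx => ?_
    have hx : 0 < x := hx
    simp only [hF, norm_mul, Complex.norm_real, Real.norm_eq_abs]
    congr 1
    split_ifs
    · rw [Complex.norm_cpow_eq_rpow_re_of_pos hx]; simp
    · simp
  have key := MeasureTheory.hasSum_integral_of_summable_integral_norm hFi
    (by simp_rw [hFn]; exact hsum.div_const _)
  have e1 : (∫ x in Set.Ioi (0:ℝ), ∑' i, F i x) = mellin (fun x => (A x : ℂ)) (-s) := by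
    rw [mellin]
    refine MeasureTheory.setIntegral_congr_fun measurableSet_Ioi fun x hx => ?_
    have h1 : HasSum (fun i => F i x) ((x : ℂ) ^ (-s - 1) * (A x : ℂ)) := by
      have h2 := ((Complex.hasSum_ofReal).2 (hA x)).mul_left ((x : ℂ) ^ (-s - 1))
      refine h2.congr_fun ?_ 
      intro i
      simp only [hF]
      split_ifs <;> simp [mul_comm]
    exact h1.tsum_eq
  rw [e1] at key
  have := key.mul_left s
  refine this.congr_fun ?_
  intro i
  simp only [hF]
  rw [MeasureTheory.integral_const_mul, (tail_cpx (hn i) hs).2]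
  field_simp

theorem dir_summable {ι : Type*} {n w : ι → ℝ} {A : ℝ → ℝ} {C σ : ℝ}
    (hn : ∀ i, 1 ≤ n i) (hs : 1 < σ) (hw : ∀ i, 0 ≤ w i)
    (hAC : ∀ x, 1 ≤ x → A x ≤ C * x)
    (hA : ∀ x, HasSum (fun i => if n i ≤ x then w i else 0) (A x)) :
    Summable (fun i => w i * n i ^ (-σ)) := by
  have hσ : 0 < σ := by linarith
  refine summable_of_sum_le (c := σ * ∫ x in Set.Ioi (0:ℝ), C * (if 1 ≤ x then x ^ (-(σ - 1) - 1) else 0)) (fun i => mul_nonneg (hw i) (Real.rpow_nonneg (by linarith [hn i]) _)) fun u => ?_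
  have h1 : ∑ i ∈ u, w i * n i ^ (-σ) = σ * ∫ x in Set.Ioi (0:ℝ), ∑ i ∈ u, w i * (if n i ≤ x then x ^ (-σ - 1) else 0) := by
    rw [MeasureTheory.integral_finsetSum _ (fun i _ => (tail_real (hn i) hσ).1.const_mul _), Finset.mul_sum]
    refine Finset.sum_congr rfl fun i _ => ?_
    rw [MeasureTheory.integral_const_mul, (tail_real (hn i) hσ).2]
    field_simp
  rw [h1]
  refine mul_le_mul_of_nonneg_left ?_ hσ.le
  refine MeasureTheory.setIntegral_mono_on ?_ ?_ measurableSet_Ioi fun x hx => ?_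
  · exact MeasureTheory.integrable_finsetSum _ fun i _ => (tail_real (hn i) hσ).1.const_mul _
  · exact (tail_real le_rfl (by linarith : 0 < σ - 1)).1.const_mul _
  · have hx : 0 < x := hx
    split_ifs with h
    · have h2 : ∑ i ∈ u, (if n i ≤ x then w i else 0) ≤ C * x :=
        (sum_le_hasSum u (fun i _ => by split_ifs; exacts [hw i, le_rfl]) (hA x)).trans (hAC x h)
      calc _ = (∑ i ∈ u, (if n i ≤ x then w i else 0)) * x ^ (-σ - 1) := by
            rw [Finset.sum_mul]
            refine Finset.sum_congr rfl fun i _ => ?_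
            split_ifs <;> simp
        _ ≤ C * x * x ^ (-σ - 1) := by gcongr
        _ = _ := by
            rw [mul_assoc]; congr 1
            nth_rewrite 1 [← Real.rpow_one x]
            rw [← Real.rpow_add hx]; congr 1; ring
    · rw [mul_zero]
      refine le_of_eq (Finset.sum_eq_zero fun i _ => ?_)
      rw [if_neg (by linarith [hn i]), mul_zero]


def gE (p : ℕ → ℝ) (e : ℕ →₀ ℕ) : ℝ := ∏ i ∈ e.support, p i ^ e i
def gS (p : ℕ → ℝ) (S : Finset ℕ) : ℝ := ∏ i ∈ S, p i
noncomputable def ind1 (S : Finset ℕ) : ℕ →₀ ℕ := Finsupp.indicator S (fun _ _ => 1)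

theorem p_gt {p : ℕ → ℝ} (hmono : Monotone p) (hp0 : 1 < p 0) (i : ℕ) : 1 < p i :=
  hp0.trans_le (hmono (Nat.zero_le i))

theorem gE_ge {p : ℕ → ℝ} (hp : ∀ i, 1 < p i) (e : ℕ →₀ ℕ) : 1 ≤ gE p e :=
  Finset.one_le_prod fun i _ => one_le_pow₀ (hp i).le

theorem gS_ge {p : ℕ → ℝ} (hp : ∀ i, 1 < p i) (e : Finset ℕ) : 1 ≤ gS p e :=
  Finset.one_le_prod fun i _ => (hp i).le

theorem gE_single_le {p : ℕ → ℝ} (hp : ∀ i, 1 < p i) (e : ℕ →₀ ℕ) (i : ℕ) : p i ^ e i ≤ gE p e := by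
  by_cases h : i ∈ e.support
  · rw [gE, ← Finset.mul_prod_erase _ _ h]
    exact le_mul_of_one_le_right (pow_nonneg (by linarith [hp i]) _)
      (Finset.one_le_prod fun i _ => one_le_pow₀ (hp i).le)
  · rw [Finsupp.notMem_support_iff.1 h]; simpa using gE_ge hp e

theorem gE_add {p : ℕ → ℝ} (e f : ℕ →₀ ℕ) : gE p (e + f) = gE p e * gE p f :=
  Finsupp.prod_add_index' (h := fun i k => p i ^ k) (fun _ => pow_zero _) (fun _ _ _ => pow_add _ _ _)

theorem ind1_apply (S : Finset ℕ) (i : ℕ) : ind1 S i = if i ∈ S then 1 else 0 := by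
  simp [ind1, Finsupp.indicator_apply]

theorem ind1_support (S : Finset ℕ) : (ind1 S).support = S := by
  ext i; simp [ind1_apply]

theorem gE_ind1 {p : ℕ → ℝ} (S : Finset ℕ) : gE p (ind1 S) = gS p S := by
  rw [gE, gS, ind1_support]
  exact Finset.prod_congr rfl fun i hi => by simp [ind1_apply, hi]

theorem ind1_inj : Function.Injective ind1 := fun S T h => by
  rw [← ind1_support S, h, ind1_support]

section
variable {p : ℕ → ℝ}

theorem exists_bd (hmono : Monotone p) (hp0 : 1 < p 0) (htop : Tendsto p atTop atTop) (x : ℝ) :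
    ∃ n0 K : ℕ, ∀ i k : ℕ, 1 ≤ k → p i ^ k ≤ x → i < n0 ∧ k < K := by
  obtain ⟨n0, hn0⟩ := (htop.eventually_gt_atTop x).exists
  obtain ⟨K, hK⟩ := pow_unbounded_of_one_lt x hp0
  refine ⟨n0, K, fun i k hk h => ⟨?_, ?_⟩⟩
  · by_contra! hi
    have h1 : p i ≤ p i ^ k := le_self_pow₀ (p_gt hmono hp0 i).le (by omega)
    linarith [hmono hi]
  · by_contra! hi
    have h1 : p 0 ^ K ≤ p 0 ^ k := pow_le_pow_right₀ hp0.le hi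
    have h2 : p 0 ^ k ≤ p i ^ k := pow_le_pow_left₀ (by linarith) (hmono (Nat.zero_le i)) k
    linarith

theorem finE (hmono : Monotone p) (hp0 : 1 < p 0) (htop : Tendsto p atTop atTop) (x : ℝ) :
    {e | gE p e ≤ x}.Finite := by
  obtain ⟨n0, K, h⟩ := exists_bd hmono hp0 htop x
  refine (Set.finite_Icc (0 : ℕ →₀ ℕ) (K • ind1 (Finset.range n0))).subset fun e he => ⟨zero_le, fun i => ?_⟩
  rcases Nat.eq_zero_or_pos (e i) with h0 | h0
  · simp [h0]
  · obtain ⟨h1, h2⟩ := h i (e i) h0 ((gE_single_le (p_gt hmono hp0) e i).trans he)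
    simp [ind1_apply, h1, h2.le]

theorem finS (hmono : Monotone p) (hp0 : 1 < p 0) (htop : Tendsto p atTop atTop) (x : ℝ) :
    {e | gS p e ≤ x}.Finite := by
  refine Set.Finite.of_injOn (f := ind1) (t := {e | gE p e ≤ x}) ?_ ind1_inj.injOn (finE hmono hp0 htop x)
  intro S hS
  simpa [gE_ind1] using hS

theorem finPsi (hmono : Monotone p) (hp0 : 1 < p 0) (htop : Tendsto p atTop atTop) (x : ℝ) :
    {ik : ℕ × ℕ | 1 ≤ ik.2 ∧ p ik.1 ^ ik.2 ≤ x}.Finite := by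
  obtain ⟨n0, K, h⟩ := exists_bd hmono hp0 htop x
  refine ((Set.finite_Iio n0).prod (Set.finite_Iio K)).subset fun ik hik => ?_
  exact h _ _ hik.1 hik.2

theorem fin_hasSum {ι : Type*} {P : ι → Prop} [DecidablePred P] {w : ι → ℝ} (h : {i | P i}.Finite) :
    HasSum (fun i => if P i then w i else 0) (∑ᶠ i ∈ {i | P i}, w i) := by
  rw [finsum_mem_eq_finite_toFinset_sum _ h]
  have : ∑ i ∈ h.toFinset, w i = ∑ i ∈ h.toFinset, (if P i then w i else 0) :=
    Finset.sum_congr rfl fun i hi => by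
      have : P i := by simpa using hi
      simp [this]
  rw [this]
  refine hasSum_sum_of_ne_finset_zero fun i hi => ?_
  have : ¬ P i := by simpa using hi
  simp [this]

theorem NP_hasSum (hmono : Monotone p) (hp0 : 1 < p 0) (htop : Tendsto p atTop atTop) (x : ℝ) :
    HasSum (fun e => if gE p e ≤ x then (1:ℝ) else 0) (NP p x) := by
  have h := finE hmono hp0 htop x
  have h1 := fin_hasSum (w := fun _ => (1:ℝ)) h
  have h2 : ∑ᶠ e ∈ {e | gE p e ≤ x}, (1:ℝ) = (NP p x : ℝ) := by
    rw [finsum_mem_eq_finite_toFinset_sum _ h]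
    simp only [Finset.sum_const, nsmul_eq_mul, mul_one]
    rw [← Set.ncard_eq_toFinset_card _ h]
    rfl
  rwa [h2] at h1

theorem MP_hasSum (hmono : Monotone p) (hp0 : 1 < p 0) (htop : Tendsto p atTop atTop) (x : ℝ) :
    HasSum (fun S => if gS p S ≤ x then (-1:ℝ) ^ S.card else 0) (MP p x) :=
  fin_hasSum (finS hmono hp0 htop x)

theorem psiP_hasSum (hmono : Monotone p) (hp0 : 1 < p 0) (htop : Tendsto p atTop atTop) (x : ℝ) :
    HasSum (fun ik : ℕ × ℕ => if p ik.1 ^ (ik.2 + 1) ≤ x then Real.log (p ik.1) else 0) (psiP p x) := by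
  have h1 : HasSum (fun ik : ℕ × ℕ => if 1 ≤ ik.2 ∧ p ik.1 ^ ik.2 ≤ x then Real.log (p ik.1) else 0) (psiP p x) :=
    fin_hasSum (w := fun ik : ℕ × ℕ => Real.log (p ik.1)) (finPsi hmono hp0 htop x)
  have hi : Function.Injective (fun ik : ℕ × ℕ => (ik.1, ik.2 + 1)) := by
    rintro ⟨a, b⟩ ⟨c, d⟩ h; simpa using h
  have := (hi.hasSum_iff (f := fun ik : ℕ × ℕ => if 1 ≤ ik.2 ∧ p ik.1 ^ ik.2 ≤ x then Real.log (p ik.1) else 0) (a := psiP p x) ?_).2 h1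
  · refine this.congr_fun fun ik => ?_
    simp
  · rintro ⟨a, b⟩ h
    rw [if_neg]
    rintro ⟨hb, -⟩
    exact h ⟨(a, b - 1), by simp at hb ⊢; omega⟩

theorem step_mono {ι : Type*} {n w : ι → ℝ} {A : ℝ → ℝ} (hw : ∀ i, 0 ≤ w i)
    (hA : ∀ x, HasSum (fun i => if n i ≤ x then w i else 0) (A x)) : Monotone A := by
  intro x y hxy
  refine hasSum_le (fun i => ?_) (hA x) (hA y)
  by_cases h : n i ≤ x
  · simp [h, h.trans hxy]
  · simp only [h, if_false]; split_ifs; exacts [hw i, le_rfl]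

theorem hasSum_zero_lt {ι : Type*} {n w : ι → ℝ} {A : ℝ → ℝ} (hn : ∀ i, 1 ≤ n i)
    (hA : ∀ x, HasSum (fun i => if n i ≤ x then w i else 0) (A x)) : ∀ x < 1, A x = 0 := by
  intro x hx
  refine (hA x).unique ?_
  have : (fun i => if n i ≤ x then w i else 0) = fun _ => 0 := by
    funext i; rw [if_neg]; linarith [hn i]
  rw [this]; exact hasSum_zero

theorem MP_sub_le (hmono : Monotone p) (hp0 : 1 < p 0) (htop : Tendsto p atTop atTop) {x y : ℝ} (hxy : x ≤ y) :
    |MP p y - MP p x| ≤ NP p y - NP p x := by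
  have hM := (MP_hasSum hmono hp0 htop y).sub (MP_hasSum hmono hp0 htop x)
  have hN := (NP_hasSum hmono hp0 htop y).sub (NP_hasSum hmono hp0 htop x)
  have hs := hN.summable.comp_injective ind1_inj
  have hfun : ∀ e, (0:ℝ) ≤ (if gE p e ≤ y then (1:ℝ) else 0) - (if gE p e ≤ x then (1:ℝ) else 0) := by
    intro e
    by_cases h : gE p e ≤ x
    · simp [h, h.trans hxy]
    · simp only [h, if_false]; split_ifs <;> norm_num
  have hb : ∀ S : Finset ℕ, |(if gS p S ≤ y then (-1:ℝ) ^ S.card else 0) - (if gS p S ≤ x then (-1:ℝ) ^ S.card else 0)| ≤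
      (if gE p (ind1 S) ≤ y then (1:ℝ) else 0) - (if gE p (ind1 S) ≤ x then (1:ℝ) else 0) := by
    intro S
    rw [gE_ind1]
    by_cases h : gS p S ≤ x
    · simp [h, h.trans hxy]
    · simp only [h, if_false]; split_ifs <;> simp
  rw [abs_le]
  constructor
  · have := hasSum_le_inj ind1 ind1_inj (fun c _ => hfun c) (fun S => (neg_le_abs _).trans (hb S)) hM.neg hN
    linarith
  · exact hasSum_le_inj ind1 ind1_inj (fun c _ => hfun c) (fun S => (le_abs_self _).trans (hb S)) hM hN

end


section
variable {p : ℕ → ℝ} {C : ℝ}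

theorem sumE (hmono : Monotone p) (hp0 : 1 < p 0) (htop : Tendsto p atTop atTop)
    (hN : ∀ x, 1 ≤ x → (NP p x : ℝ) ≤ C * x) {σ : ℝ} (hσ : 1 < σ) :
    Summable fun e => gE p e ^ (-σ) := by
  have := dir_summable (n := gE p) (w := fun _ => 1) (gE_ge (p_gt hmono hp0)) hσ (by simp) hN
    (NP_hasSum hmono hp0 htop)
  simpa using this

theorem sumS (hmono : Monotone p) (hp0 : 1 < p 0) (htop : Tendsto p atTop atTop)
    (hN : ∀ x, 1 ≤ x → (NP p x : ℝ) ≤ C * x) {σ : ℝ} (hσ : 1 < σ) :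
    Summable fun S => gS p S ^ (-σ) := by
  have := (sumE hmono hp0 htop hN hσ).comp_injective ind1_inj
  refine this.congr fun S => ?_
  simp [gE_ind1]

theorem sumP (hmono : Monotone p) (hp0 : 1 < p 0) (htop : Tendsto p atTop atTop)
    (hN : ∀ x, 1 ≤ x → (NP p x : ℝ) ≤ C * x) {σ : ℝ} (hσ : 1 < σ) :
    Summable fun i => p i ^ (-σ) := by
  have := (sumS hmono hp0 htop hN hσ).comp_injective (Finset.singleton_injective (α := ℕ))
  refine this.congr fun S => ?_
  simp [gS]

theorem serN (hmono : Monotone p) (hp0 : 1 < p 0) (htop : Tendsto p atTop atTop)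
    (hN : ∀ x, 1 ≤ x → (NP p x : ℝ) ≤ C * x) {s : ℂ} (hs : 1 < s.re) :
    HasSum (fun e => (gE p e : ℂ) ^ (-s)) (s * mellin (fun x => ((NP p x : ℝ) : ℂ)) (-s)) := by
  have := dir_hasSum (n := gE p) (w := fun _ => 1) (s := s) (gE_ge (p_gt hmono hp0)) (by linarith)
    (by simpa using sumE hmono hp0 htop hN hs) (NP_hasSum hmono hp0 htop)
  simpa using this

theorem serM (hmono : Monotone p) (hp0 : 1 < p 0) (htop : Tendsto p atTop atTop)
    (hN : ∀ x, 1 ≤ x → (NP p x : ℝ) ≤ C * x) {s : ℂ} (hs : 1 < s.re) :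
    HasSum (fun S => (-1) ^ S.card * (gS p S : ℂ) ^ (-s)) (s * mellin (fun x => (MP p x : ℂ)) (-s)) := by
  have := dir_hasSum (n := gS p) (s := s) (gS_ge (p_gt hmono hp0)) (by linarith)
    (by simpa using sumS hmono hp0 htop hN hs) (MP_hasSum hmono hp0 htop)
  simpa using this

theorem sumPsi (hmono : Monotone p) (hp0 : 1 < p 0) (htop : Tendsto p atTop atTop)
    (hN : ∀ x, 1 ≤ x → psiP p x ≤ C * x) {σ : ℝ} (hσ : 1 < σ) :
    Summable fun ik : ℕ × ℕ => Real.log (p ik.1) * (p ik.1 ^ (ik.2 + 1)) ^ (-σ) :=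
  dir_summable (n := fun ik : ℕ × ℕ => p ik.1 ^ (ik.2 + 1))
    (fun ik => one_le_pow₀ (p_gt hmono hp0 ik.1).le) hσ
    (fun ik => Real.log_nonneg (p_gt hmono hp0 ik.1).le) hN (psiP_hasSum hmono hp0 htop)

theorem serPsi (hmono : Monotone p) (hp0 : 1 < p 0) (htop : Tendsto p atTop atTop)
    (hN : ∀ x, 1 ≤ x → psiP p x ≤ C * x) {s : ℂ} (hs : 1 < s.re) :
    HasSum (fun ik : ℕ × ℕ => (Real.log (p ik.1) : ℂ) * ((p ik.1 ^ (ik.2 + 1) : ℝ) : ℂ) ^ (-s))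
      (s * mellin (fun x => (psiP p x : ℂ)) (-s)) :=
  dir_hasSum (n := fun ik : ℕ × ℕ => p ik.1 ^ (ik.2 + 1))
    (fun ik => one_le_pow₀ (p_gt hmono hp0 ik.1).le) (by linarith)
    ((sumPsi hmono hp0 htop hN hs).congr fun ik => by
      rw [abs_of_nonneg (Real.log_nonneg (p_gt hmono hp0 ik.1).le)]) (psiP_hasSum hmono hp0 htop)

noncomputable def convEquiv : Finset ℕ × (ℕ →₀ ℕ) ≃ Σ f : ℕ →₀ ℕ, {S : Finset ℕ // S ∈ f.support.powerset} where
  toFun x := ⟨x.2 + ind1 x.1, x.1, by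
    rw [Finset.mem_powerset]
    intro i hi
    simp [ind1_apply, hi]⟩
  invFun y := (y.2.1, y.1 - ind1 y.2.1)
  left_inv x := by simp
  right_inv y := by
    obtain ⟨f, S, hS⟩ := y
    have h : f - ind1 S + ind1 S = f := by
      refine tsub_add_cancel_of_le fun i => ?_
      rw [ind1_apply]
      split_ifs with hi
      · have := Finset.mem_powerset.1 hS hi
        simp at this; omega
      · simp
    refine Sigma.subtype_ext ?_ rfl
    exact h

theorem euler (hmono : Monotone p) (hp0 : 1 < p 0) (htop : Tendsto p atTop atTop)
    (hN : ∀ x, 1 ≤ x → (NP p x : ℝ) ≤ C * x) {s : ℂ} (hs : 1 < s.re) :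
    (s * mellin (fun x => (MP p x : ℂ)) (-s)) * (s * mellin (fun x => ((NP p x : ℝ) : ℂ)) (-s)) = 1 := by
  have hp := p_gt hmono hp0
  have hE0 : ∀ e, 0 < gE p e := fun e => one_pos.trans_le (gE_ge hp e)
  have hS0 : ∀ e, 0 < gS p e := fun e => one_pos.trans_le (gS_ge hp e)
  have h1 := serM hmono hp0 htop hN hs
  have h2 := serN hmono hp0 htop hN hs
  have n1 : Summable fun S => ‖(-1) ^ S.card * (gS p S : ℂ) ^ (-s)‖ := by
    refine (sumS hmono hp0 htop hN hs).congr fun S => ?_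
    rw [norm_mul, norm_pow, norm_neg, norm_one, one_pow, one_mul,
      Complex.norm_cpow_eq_rpow_re_of_pos (hS0 S), Complex.neg_re]
  have n2 : Summable fun e => ‖(gE p e : ℂ) ^ (-s)‖ := by
    refine (sumE hmono hp0 htop hN hs).congr fun S => ?_
    rw [Complex.norm_cpow_eq_rpow_re_of_pos (hE0 S), Complex.neg_re]
  have h3 := summable_mul_of_summable_norm n1 n2
  have h4 := h1.mul h2 h3
  have h5 := (convEquiv.symm.hasSum_iff).2 h4
  have h6 := h5.sigma (fun f => hasSum_fintype _)
  refine h6.unique ?_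
  have h7 : ∀ f : ℕ →₀ ℕ, ∑ S : {S : Finset ℕ // S ∈ f.support.powerset},
      ((fun x : Finset ℕ × (ℕ →₀ ℕ) => (-1) ^ x.1.card * (gS p x.1 : ℂ) ^ (-s) * (gE p x.2 : ℂ) ^ (-s)) ∘ convEquiv.symm) ⟨f, S⟩
      = if f = 0 then 1 else 0 := by
    intro f
    have h8 : ∀ S : {S : Finset ℕ // S ∈ f.support.powerset},
      ((fun x : Finset ℕ × (ℕ →₀ ℕ) => (-1) ^ x.1.card * (gS p x.1 : ℂ) ^ (-s) * (gE p x.2 : ℂ) ^ (-s)) ∘ convEquiv.symm) ⟨f, S⟩ =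
        (-1) ^ S.1.card * (gE p f : ℂ) ^ (-s) := by
      intro S
      have h9 : gE p f = gS p S.1 * gE p (f - ind1 S.1) := by
        have := congrArg Sigma.fst (convEquiv.apply_symm_apply ⟨f, S⟩)
        have h10 : f - ind1 S.1 + ind1 S.1 = f := this
        conv_lhs => rw [← h10]
        rw [gE_add, gE_ind1, mul_comm]
      rw [h9, Complex.ofReal_mul, Complex.mul_cpow_ofReal_nonneg (hS0 _).le (hE0 _).le, ← mul_assoc]
      rfl
    rw [Finset.sum_congr rfl fun S _ => h8 S]
    rw [Finset.sum_coe_sort f.support.powerset (fun S : Finset ℕ => (-1) ^ S.card * (gE p f : ℂ) ^ (-s)), ← Finset.sum_mul]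
    have h11 : ∑ S ∈ f.support.powerset, (-1 : ℂ) ^ S.card = if f = 0 then 1 else 0 := by
      have := congrArg (Int.cast (R := ℂ)) (Finset.sum_powerset_neg_one_pow_card (x := f.support))
      push_cast at this
      rw [this]
      simp
    rw [h11]
    split_ifs with h
    · subst h; simp [gE]
    · simp
  have h12 := hasSum_ite_eq (0 : ℕ →₀ ℕ) (1 : ℂ)
  exact h12.congr_fun h7
end


section
variable {p : ℕ → ℝ} {C C2 : ℝ}

theorem norm_ps (hp : ∀ i, 1 < p i) (i : ℕ) (s : ℂ) : ‖(p i : ℂ) ^ (-s)‖ = p i ^ (-s.re) := by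
  rw [Complex.norm_cpow_eq_rpow_re_of_pos (by linarith [hp i]), Complex.neg_re]

theorem ps_le (hmono : Monotone p) (hp0 : 1 < p 0) (i : ℕ) {σ τ : ℝ} (hσ : 0 ≤ σ) (h : σ ≤ τ) :
    p i ^ (-τ) ≤ p 0 ^ (-σ) := by
  have h1 : p i ^ (-τ) ≤ p i ^ (-σ) :=
    Real.rpow_le_rpow_of_exponent_le (p_gt hmono hp0 i).le (by linarith)
  exact h1.trans (Real.rpow_le_rpow_of_nonpos (by linarith) (hmono (Nat.zero_le i)) (by linarith))

noncomputable def L0 (p : ℕ → ℝ) (s : ℂ) : ℂ := ∑' i, - Complex.log (1 - (p i : ℂ) ^ (-s))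

theorem log_bd (hmono : Monotone p) (hp0 : 1 < p 0) {σ : ℝ} (hσ : 0 < σ) {s : ℂ} (hs : σ ≤ s.re) (i : ℕ) :
    ‖- Complex.log (1 - (p i : ℂ) ^ (-s))‖ ≤ ((1 - p 0 ^ (-σ))⁻¹ + 1) * p i ^ (-σ) := by
  have hp := p_gt hmono hp0
  have hq : p 0 ^ (-σ) < 1 := Real.rpow_lt_one_of_one_lt_of_neg hp0 (by linarith)
  have h1 : ‖-(p i : ℂ) ^ (-s)‖ ≤ p i ^ (-σ) := by
    rw [norm_neg, norm_ps hp]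
    exact Real.rpow_le_rpow_of_exponent_le (hp i).le (by linarith)
  have h2 : p i ^ (-σ) ≤ p 0 ^ (-σ) := ps_le hmono hp0 i hσ.le le_rfl
  set z := -(p i : ℂ) ^ (-s) with hz
  have h3 := Complex.norm_log_one_add_le (z := z) (by linarith)
  rw [norm_neg, sub_eq_add_neg, ← hz]
  refine h3.trans ?_
  have h4 : (1 - ‖z‖)⁻¹ ≤ (1 - p 0 ^ (-σ))⁻¹ := by
    apply inv_anti₀ <;> linarith
  have h5 : 0 ≤ (1 - ‖z‖)⁻¹ := inv_nonneg.2 (by linarith)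
  have h6 : ‖z‖ ^ 2 ≤ ‖z‖ := by nlinarith [norm_nonneg z]
  have h7 : ‖z‖ ^ 2 * (1 - ‖z‖)⁻¹ / 2 ≤ ‖z‖ * (1 - p 0 ^ (-σ))⁻¹ := by
    have : ‖z‖ ^ 2 * (1 - ‖z‖)⁻¹ ≤ ‖z‖ * (1 - p 0 ^ (-σ))⁻¹ := by gcongr
    have h0 : 0 ≤ ‖z‖ ^ 2 * (1 - ‖z‖)⁻¹ := by positivity
    linarith
  have h8 : 0 ≤ (1 - p 0 ^ (-σ))⁻¹ := h5.trans h4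
  nlinarith

theorem L0_summable (hmono : Monotone p) (hp0 : 1 < p 0) (htop : Tendsto p atTop atTop)
    (hN : ∀ x, 1 ≤ x → (NP p x : ℝ) ≤ C * x) {s : ℂ} (hs : 1 < s.re) :
    Summable fun i => - Complex.log (1 - (p i : ℂ) ^ (-s)) :=
  Summable.of_norm_bounded ((sumP hmono hp0 htop hN hs).mul_left _)
    (log_bd hmono hp0 (by linarith) le_rfl)

theorem L0_bound (hmono : Monotone p) (hp0 : 1 < p 0) (htop : Tendsto p atTop atTop)
    (hN : ∀ x, 1 ≤ x → (NP p x : ℝ) ≤ C * x) : ∃ B, ∀ s : ℂ, 2 ≤ s.re → ‖L0 p s‖ ≤ B :=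
  ⟨_, fun _ hs => tsum_of_norm_bounded (((sumP hmono hp0 htop hN one_lt_two).mul_left _).hasSum)
    (log_bd hmono hp0 two_pos hs)⟩

theorem one_sub_ne (hp : ∀ i, 1 < p i) (i : ℕ) {s : ℂ} (hs : 0 < s.re) :
    ‖(p i : ℂ) ^ (-s)‖ < 1 := by
  rw [norm_ps hp]
  exact Real.rpow_lt_one_of_one_lt_of_neg (hp i) (by linarith)

theorem one_sub_slit {z : ℂ} (hz : ‖z‖ < 1) : 1 - z ∈ Complex.slitPlane := by
  left
  have := Complex.re_le_norm z
  simp; linarith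

theorem exp_neg_L0 (hmono : Monotone p) (hp0 : 1 < p 0) (htop : Tendsto p atTop atTop)
    (hN : ∀ x, 1 ≤ x → (NP p x : ℝ) ≤ C * x) {s : ℂ} (hs : 1 < s.re) :
    Complex.exp (- L0 p s) = s * mellin (fun x => (MP p x : ℂ)) (-s) := by
  have hp := p_gt hmono hp0
  have h1 := (L0_summable hmono hp0 htop hN hs).hasSum.neg.cexp
  have h2 := serM hmono hp0 htop hN hs
  have h3 : HasSum (fun S : Finset ℕ => ∏ i ∈ S, (-(p i : ℂ) ^ (-s))) (s * mellin (fun x => (MP p x : ℂ)) (-s)) := by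
    refine h2.congr_fun fun S => ?_
    rw [Finset.prod_neg, gS]
    congr 1
    push_cast
    induction S using Finset.induction_on with
    | empty => simp
    | insert a S ha ih =>
      rw [Finset.prod_insert ha, Finset.prod_insert ha, ih]
      have : (∏ x ∈ S, (p x : ℂ)) = ((gS p S : ℝ) : ℂ) := by simp [gS]
      rw [this, Complex.mul_cpow_ofReal_nonneg (by linarith [hp a]) (by linarith [gS_ge hp S])]
  have h4 := hasProd_one_add_of_hasSum_prod h3
  refine h1.unique (h4.congr_fun fun i => ?_)
  have := one_sub_ne hp i (s := s) (by linarith)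
  simp only [Function.comp, neg_neg]
  rw [Complex.exp_log (Complex.slitPlane_ne_zero (one_sub_slit this)), sub_eq_add_neg]

theorem exp_L0 (hmono : Monotone p) (hp0 : 1 < p 0) (htop : Tendsto p atTop atTop)
    (hN : ∀ x, 1 ≤ x → (NP p x : ℝ) ≤ C * x) {s : ℂ} (hs : 1 < s.re) :
    Complex.exp (L0 p s) = s * mellin (fun x => ((NP p x : ℝ) : ℂ)) (-s) := by
  have h1 := euler hmono hp0 htop hN hs
  rw [← exp_neg_L0 hmono hp0 htop hN hs, Complex.exp_neg] at h1
  have := Complex.exp_ne_zero (L0 p s)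
  field_simp at h1
  exact h1.symm

theorem L0_deriv (hmono : Monotone p) (hp0 : 1 < p 0) (htop : Tendsto p atTop atTop)
    (hN : ∀ x, 1 ≤ x → (NP p x : ℝ) ≤ C * x) (hψ : ∀ x, 1 ≤ x → psiP p x ≤ C2 * x)
    {s : ℂ} (hs : 1 < s.re) :
    HasDerivAt (L0 p) (-(s * mellin (fun x => (psiP p x : ℂ)) (-s))) s := by
  have hp := p_gt hmono hp0
  set σ := (1 + s.re) / 2 with hσ
  have hσ1 : 1 < σ := by linarith
  have hσ2 : σ < s.re := by linarith
  have hq : p 0 ^ (-σ) < 1 := Real.rpow_lt_one_of_one_lt_of_neg hp0 (by linarith)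
  set g' : ℕ → ℂ → ℂ := fun i y => -((Real.log (p i) : ℂ) * ((p i : ℂ) ^ (-y) / (1 - (p i : ℂ) ^ (-y)))) with hg'
  have hu : Summable fun i => Real.log (p i) * (p i ^ (-σ) / (1 - p 0 ^ (-σ))) := by
    have h1 := (sumPsi hmono hp0 htop hψ hσ1).comp_injective
      (i := fun i : ℕ => (i, 0)) (fun a b h => by simpa using h)
    refine (h1.div_const (1 - p 0 ^ (-σ))).congr fun i => ?_
    simp [mul_div_assoc]
  have hd : HasDerivAt (L0 p) (∑' i, g' i s) s := by
    refine hasDerivAt_tsum_of_isPreconnected (t := {z : ℂ | σ < z.re}) hu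
      (isOpen_lt continuous_const Complex.continuous_re)
      (convex_halfSpace_re_gt σ).isPreconnected ?_ ?_ hσ2 (L0_summable hmono hp0 htop hN hs) hσ2
    · intro i y hy
      have hy : σ < y.re := hy
      have hn := one_sub_ne hp i (s := y) (by linarith)
      have hpi : (p i : ℂ) ≠ 0 := by have := hp i; exact_mod_cast (by linarith : p i ≠ 0)
      have h1 : HasDerivAt (fun y : ℂ => (p i : ℂ) ^ (-y)) ((p i : ℂ) ^ (-y) * Complex.log (p i) * (-1)) y :=
        (hasDerivAt_neg y).const_cpow (Or.inl hpi)
      have h2 := ((h1.const_sub 1).clog (one_sub_slit hn)).neg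
      refine h2.congr_deriv ?_
      simp only [hg']
      rw [Complex.ofReal_log (by linarith [hp i])]
      ring
    · intro i y hy
      have hy : σ < y.re := hy
      have hn := one_sub_ne hp i (s := y) (by linarith)
      simp only [hg']
      rw [norm_neg, norm_mul, norm_div, Complex.norm_real, Real.norm_eq_abs, abs_of_nonneg (Real.log_nonneg (hp i).le)]
      have h1 : ‖(p i : ℂ) ^ (-y)‖ ≤ p i ^ (-σ) := by
        rw [norm_ps hp]
        exact Real.rpow_le_rpow_of_exponent_le (hp i).le (by linarith)
      have h2 : p i ^ (-σ) ≤ p 0 ^ (-σ) := ps_le hmono hp0 i (by linarith) le_rfl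
      have h3 : 1 - p 0 ^ (-σ) ≤ ‖1 - (p i : ℂ) ^ (-y)‖ := by
        have := norm_sub_norm_le (1 : ℂ) ((p i : ℂ) ^ (-y))
        rw [norm_one] at this
        linarith
      have := Real.log_nonneg (hp i).le
      have h4 : 0 < 1 - p 0 ^ (-σ) := by linarith
      have h5 : 0 ≤ p i ^ (-σ) := (norm_nonneg _).trans h1
      gcongr
  have hsum : ∑' i, g' i s = -(s * mellin (fun x => (psiP p x : ℂ)) (-s)) := by
    have h1 := serPsi hmono hp0 htop hψ hs
    have h2 : ∀ i, HasSum (fun k : ℕ => (Real.log (p i) : ℂ) * ((p i ^ (k + 1) : ℝ) : ℂ) ^ (-s)) (-(g' i s)) := by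
      intro i
      have hn := one_sub_ne hp i (s := s) (by linarith)
      have h3 := ((hasSum_geometric_of_norm_lt_one hn).mul_left ((p i : ℂ) ^ (-s))).mul_left (Real.log (p i) : ℂ)
      simp only [hg', neg_neg]
      rw [div_eq_mul_inv]
      refine h3.congr_fun fun k => ?_
      congr 1
      rw [← pow_succ']
      induction k with
      | zero => simp
      | succ k ih =>
        rw [pow_succ (p i), Complex.ofReal_mul, Complex.mul_cpow_ofReal_nonneg (pow_nonneg (by linarith [hp i]) _) (by linarith [hp i]), ih, ← pow_succ]
    have h4 := h1.prod_fiberwise h2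
    have h5 := h4.neg
    simp only [neg_neg] at h5
    exact h5.tsum_eq
  rwa [hsum] at hd
end


theorem hp_open (δ : ℝ) : IsOpen {s : ℂ | δ < s.re} :=
  isOpen_lt continuous_const Complex.continuous_re

theorem ident {f g : ℂ → ℂ} {δ : ℝ} (hf : DifferentiableOn ℂ f {s | δ < s.re})
    (hg : DifferentiableOn ℂ g {s | δ < s.re}) (h : ∀ s : ℂ, 1 < s.re → f s = g s) :
    ∀ s : ℂ, δ < s.re → f s = g s := by
  have h1 := (hf.analyticOnNhd (hp_open δ)).eqOn_of_preconnected_of_eventuallyEq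
    (hg.analyticOnNhd (hp_open δ)) (convex_halfSpace_re_gt δ).isPreconnected
    (z₀ := ((max δ 1 + 1 : ℝ) : ℂ)) (by
      show δ < (((max δ 1 + 1 : ℝ)) : ℂ).re
      rw [Complex.ofReal_re]
      have := le_max_left δ 1
      linarith) ?_
  · exact fun s hs => h1 hs
  · have : {s : ℂ | 1 < s.re} ∈ nhds ((max δ 1 + 1 : ℝ) : ℂ) := (hp_open 1).mem_nhds (by
      show 1 < (((max δ 1 + 1 : ℝ)) : ℂ).re
      rw [Complex.ofReal_re]
      have := le_max_right δ 1
      linarith)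
    filter_upwards [this] with s hs using h s hs

noncomputable def remF (A : ℝ → ℝ) (c x : ℝ) : ℝ := A x - (if 1 ≤ x then c * x else 0)

theorem lin_bound {A : ℝ → ℝ} {c θ : ℝ} (hA : Monotone A)
    (hO : (fun x => A x - c * x) =O[atTop] fun x : ℝ => x ^ θ) (hθ : θ ≤ 1) :
    ∃ C, ∀ x, 1 ≤ x → A x ≤ C * x := by
  have h1 : (fun x : ℝ => x ^ θ) =O[atTop] fun x : ℝ => x := by
    refine IsBigO.of_bound 1 ?_
    filter_upwards [eventually_ge_atTop 1] with x hx
    rw [Real.norm_eq_abs, Real.norm_eq_abs, abs_of_nonneg (by positivity), abs_of_nonneg (by linarith), one_mul]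
    calc x ^ θ ≤ x ^ (1:ℝ) := Real.rpow_le_rpow_of_exponent_le hx hθ
      _ = x := Real.rpow_one x
  have h2 : (fun x : ℝ => c * x) =O[atTop] fun x : ℝ => x := (isBigO_refl _ _).const_mul_left c
  have h3 : A =O[atTop] fun x : ℝ => x := by
    have := (hO.trans h1).add h2
    simpa using this
  obtain ⟨C, hC⟩ := h3.bound
  obtain ⟨X, hX⟩ := (hC.and (eventually_ge_atTop 1)).exists_forall_of_atTop
  have hX1 := (hX X le_rfl).2
  have hb : ∀ x, X ≤ x → A x ≤ |C| * x := by
    intro x hx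
    obtain ⟨h4, h5⟩ := hX x hx
    rw [Real.norm_eq_abs, Real.norm_eq_abs, abs_of_nonneg (by linarith : 0 ≤ x)] at h4
    refine (le_abs_self _).trans (h4.trans ?_)
    gcongr
    exact le_abs_self C
  refine ⟨|C| * X, fun x hx => ?_⟩
  rcases le_total X x with h | h
  · refine (hb x h).trans ?_
    gcongr
    nlinarith [abs_nonneg C]
  · refine (hA h).trans ((hb X le_rfl).trans ?_)
    have : 0 ≤ |C| * X := by positivity
    nlinarith

theorem mellin_step {c : ℝ} {s : ℂ} (hs : 1 < s.re) :
    mellin (fun x : ℝ => (((if 1 ≤ x then c * x else 0 : ℝ)) : ℂ)) (-s) = c / (s - 1) := by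
  have h1 := (tail_cpx (n := 1) (s := s - 1) le_rfl (by simpa using hs)).2
  simp only [Complex.ofReal_one, Complex.one_cpow] at h1
  rw [mellin, div_eq_mul_one_div, ← h1, ← MeasureTheory.integral_const_mul]
  refine MeasureTheory.setIntegral_congr_fun measurableSet_Ioi fun x hx => ?_
  have hx : 0 < x := hx
  have hx0 : (x : ℂ) ≠ 0 := by exact_mod_cast hx.ne'
  simp only [smul_eq_mul]
  split_ifs
  · have : -(s - 1) - 1 = (-s - 1) + 1 := by ring
    rw [this, Complex.cpow_add _ _ hx0, Complex.cpow_one]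
    push_cast
    ring
  · simp

theorem rem_pack {A : ℝ → ℝ} {c θ : ℝ} (hA : Monotone A) (hA0 : ∀ x < 1, A x = 0)
    (hO : (fun x => A x - c * x) =O[atTop] fun x : ℝ => x ^ θ) (hθ : θ < 1) :
    ∃ C0, (∀ x, 1 ≤ x → |A x| ≤ C0 * x) ∧ Measurable (remF A c) ∧ (∀ x < 1, remF A c x = 0) ∧
      (∀ x, 1 ≤ x → |remF A c x| ≤ C0 * x) ∧
      ((fun x => (remF A c x : ℂ)) =O[atTop] fun x : ℝ => x ^ θ) ∧
      ∀ s : ℂ, 1 < s.re → mellin (fun x => (A x : ℂ)) (-s) = mellin (fun x => (remF A c x : ℂ)) (-s) + c / (s - 1) := by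
  obtain ⟨C, hC⟩ := lin_bound hA hO hθ.le
  have hnn : ∀ x, 1 ≤ x → 0 ≤ A x := fun x hx => by
    rw [← hA0 0 one_pos]; exact hA (by linarith)
  have hm : Measurable (remF A c) := by
    refine hA.measurable.sub ?_
    exact Measurable.ite measurableSet_Ici (by fun_prop) measurable_const
  have h0 : ∀ x < 1, remF A c x = 0 := fun x hx => by
    rw [remF, hA0 x hx, if_neg (by linarith), sub_zero]
  have hAb : ∀ x, 1 ≤ x → |A x| ≤ (C + |c|) * x := fun x hx => by
    rw [abs_of_nonneg (hnn x hx)]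
    have := hC x hx
    nlinarith [abs_nonneg c]
  have hRb : ∀ x, 1 ≤ x → |remF A c x| ≤ (C + |c|) * x := fun x hx => by
    rw [remF, if_pos hx]
    have h1 := hC x hx
    have h2 := hnn x hx
    have h3 : |c * x| = |c| * x := by rw [abs_mul, abs_of_nonneg (by linarith : 0 ≤ x)]
    have h4 := abs_sub (A x) (c * x)
    rw [abs_of_nonneg h2, h3] at h4
    linarith
  have hRO : (fun x => (remF A c x : ℂ)) =O[atTop] fun x : ℝ => x ^ θ := by
    have h1 : (fun x => remF A c x) =O[atTop] fun x : ℝ => x ^ θ := by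
      refine hO.congr' ?_ EventuallyEq.rfl
      filter_upwards [eventually_ge_atTop 1] with x hx
      rw [remF, if_pos hx]
    refine IsBigO.trans (IsBigO.of_bound 1 (Eventually.of_forall fun x => ?_)) h1
    rw [Complex.norm_real, one_mul]
  refine ⟨C + |c|, hAb, hm, h0, hRb, hRO, fun s hs => ?_⟩
  have c1 := mellinConv_neg (s := s) (locInt_complex (locInt_of_bound hm h0 hRb))
    (fun x hx => by rw [h0 x hx, Complex.ofReal_zero]) hRO (by linarith)
  have c2 := mellinConv_neg (s := s) (locInt_complex (locInt_of_bound hA.measurable hA0 hAb))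
    (fun x hx => by rw [hA0 x hx, Complex.ofReal_zero]) (isBigO_of_bound hAb) hs
  have h1 := (hasMellin_sub c2 c1).2
  rw [sub_eq_iff_eq_add'.1 h1.symm, ← mellin_step hs]
  congr 2
  funext x
  simp [remF]

theorem rem_diff {A : ℝ → ℝ} {C θ δ : ℝ} (hm : Measurable A) (h0 : ∀ x < 1, A x = 0)
    (hb : ∀ x, 1 ≤ x → |A x| ≤ C * x) (hO : (fun x => (A x : ℂ)) =O[atTop] fun x : ℝ => x ^ θ)
    (hδ : θ < δ) :
    DifferentiableOn ℂ (fun s => mellin (fun x => (A x : ℂ)) (-s)) {s | δ < s.re} ∧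
    ∃ C, 0 ≤ C ∧ ∀ s : ℂ, δ < s.re → ‖mellin (fun x => (A x : ℂ)) (-s)‖ ≤ C := by
  have hl := locInt_complex (locInt_of_bound hm h0 hb)
  have hz : ∀ x < 1, (A x : ℂ) = 0 := fun x hx => by rw [h0 x hx, Complex.ofReal_zero]
  constructor
  · intro s hs
    have hs : δ < s.re := hs
    exact (mellin_neg_diffAt hl hz hO (by linarith)).differentiableWithinAt
  · obtain ⟨C, h1, h2⟩ := norm_mellin_neg_le hl hz hO hδ
    exact ⟨C, h1, fun s hs => h2 s hs.le⟩

theorem core {p : ℕ → ℝ} (hmono : Monotone p) (hp0 : 1 < p 0) (htop : Tendsto p atTop atTop)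
    {CN θ δ : ℝ} (hN : ∀ x, 1 ≤ x → (NP p x : ℝ) ≤ CN * x)
    (hψ : (fun x => psiP p x - x) =O[atTop] fun x : ℝ => x ^ θ) (hθ1 : θ < 1) (hθ : θ < δ) (hδ0 : 0 < δ) (hδ1 : δ < 1) :
    ∃ L : ℂ → ℂ, DifferentiableOn ℂ L {s | δ < s.re} ∧
      (∀ s : ℂ, 1 < s.re → Complex.exp (L s) = (s - 1) * mellin (fun x => ((NP p x : ℝ) : ℂ)) (-s)) ∧
      (∀ s : ℂ, 1 < s.re → (s - 1) * Complex.exp (-L s) = s ^ 2 * mellin (fun x => (MP p x : ℂ)) (-s)) ∧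
      ∃ B, ∀ s : ℂ, 2 ≤ s.re → |(L s).re| ≤ B := by
  have hp := p_gt hmono hp0
  have hψm : Monotone (psiP p) := step_mono (n := fun ik : ℕ × ℕ => p ik.1 ^ (ik.2 + 1))
    (fun ik => Real.log_nonneg (hp ik.1).le) (psiP_hasSum hmono hp0 htop)
  have hψ0 : ∀ x < 1, psiP p x = 0 := hasSum_zero_lt (n := fun ik : ℕ × ℕ => p ik.1 ^ (ik.2 + 1))
    (fun ik => one_le_pow₀ (hp ik.1).le) (psiP_hasSum hmono hp0 htop)
  obtain ⟨C0, hb, hm, h0, hRb, hRO, hmel⟩ := rem_pack (c := 1) hψm hψ0 (by simpa using hψ) hθ1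
  obtain ⟨hEd, -⟩ := rem_diff hm h0 hRb hRO hθ
  set E : ℂ → ℂ := fun s => mellin (fun x => (remF (psiP p) 1 x : ℂ)) (-s) with hE
  have hne : ∀ s : ℂ, 0 < s.re → s ≠ 0 := by
    rintro s hs rfl; simp at hs
  have hHd : DifferentiableOn ℂ (fun s => -1 - 1 / s - s * E s) {s | δ < s.re} := by
    intro s hs
    have hs' : δ < s.re := hs
    have h1 : DifferentiableWithinAt ℂ (fun s : ℂ => 1 / s) {s | δ < s.re} s :=
      (differentiableAt_const _).differentiableWithinAt.div differentiableWithinAt_id (hne s (by linarith))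
    exact ((differentiableWithinAt_const _).sub h1).sub (differentiableWithinAt_id.mul (hEd s hs))
  obtain ⟨L1, hL1⟩ := (convex_halfSpace_re_gt δ).exists_forall_hasDerivWithinAt hHd
  have hL1' : ∀ s : ℂ, δ < s.re → HasDerivAt L1 (-1 - 1 / s - s * E s) s := fun s hs =>
    (hL1 s hs).hasDerivAt ((hp_open δ).mem_nhds hs)
  have hinv : ∀ s : ℂ, 1 < s.re → ‖1 / s‖ < 1 := by
    intro s hs
    have := Complex.re_le_norm s
    rw [norm_div, norm_one, div_lt_one (by linarith)]
    linarith
  set L2 : ℂ → ℂ := fun s => L0 p s + Complex.log (1 - 1 / s) with hL2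
  have hL2' : ∀ s : ℂ, 1 < s.re → HasDerivAt L2 (-1 - 1 / s - s * E s) s := by
    intro s hs
    have hs0 := hne s (by linarith)
    have hs1 : s - 1 ≠ 0 := by
      intro h
      have := congrArg Complex.re h
      simp at this; linarith
    have h1 := L0_deriv (C2 := C0) hmono hp0 htop hN (fun x hx => (le_abs_self _).trans (hb x hx)) hs
    have h2 : HasDerivAt (fun s : ℂ => 1 - 1 / s) (1 / s ^ 2) s := by
      have := ((hasDerivAt_inv hs0).const_sub 1)
      simp only [one_div]
      refine this.congr_deriv (by simp)
    have h3 := h1.add (h2.clog (one_sub_slit (hinv s hs)))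
    refine h3.congr_deriv ?_
    rw [hmel s hs]
    have h4 : (1 - 1 / s) = (s - 1) / s := by field_simp
    rw [h4]
    simp only [hE]
    push_cast
    field_simp
    ring
  have hconst : ∀ s : ℂ, 1 < s.re → L1 s - L2 s = L1 2 - L2 2 := by
    intro s hs
    have hd : ∀ s : ℂ, 1 < s.re → HasDerivAt (fun s => L1 s - L2 s) 0 s := fun s hs => by
      have := (hL1' s (by linarith)).sub (hL2' s hs)
      rwa [sub_self] at this
    exact (hp_open 1).is_const_of_deriv_eq_zero (convex_halfSpace_re_gt 1).isPreconnected
      (f := fun s => L1 s - L2 s)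
      (fun s hs => (hd s hs).differentiableAt.differentiableWithinAt)
      (fun s hs => (hd s hs).deriv) hs (by simp)
  have hLeq : ∀ s : ℂ, 1 < s.re → L1 s - (L1 2 - L2 2) = L0 p s + Complex.log (1 - 1 / s) := by
    intro s hs
    rw [← hconst s hs]; simp [hL2]
  have hexp : ∀ s : ℂ, 1 < s.re → Complex.exp (Complex.log (1 - 1 / s)) = (s - 1) / s := by
    intro s hs
    have hs0 := hne s (by linarith)
    rw [Complex.exp_log (Complex.slitPlane_ne_zero (one_sub_slit (hinv s hs)))]
    field_simp
  obtain ⟨B, hB⟩ := L0_bound hmono hp0 htop hN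
  refine ⟨fun s => L1 s - (L1 2 - L2 2), ?_, ?_, ?_, B + 1, ?_⟩
  · intro s hs
    exact ((hL1' s hs).differentiableAt.sub_const _).differentiableWithinAt
  · intro s hs
    have hs0 := hne s (by linarith)
    simp only [hLeq s hs]
    rw [Complex.exp_add, hexp s hs, exp_L0 hmono hp0 htop hN hs]
    field_simp
  · intro s hs
    have hs0 := hne s (by linarith)
    have hs1 : s - 1 ≠ 0 := by
      intro h
      have := congrArg Complex.re h
      simp at this; linarith
    simp only [hLeq s hs]
    rw [neg_add, Complex.exp_add, Complex.exp_neg (Complex.log _), hexp s hs, exp_neg_L0 hmono hp0 htop hN hs]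
    field_simp
  · intro s hs
    simp only [hLeq s (by linarith)]
    have h1 : ‖-(1 / s)‖ ≤ 1 / 2 := by
      have := Complex.re_le_norm s
      rw [norm_neg, norm_div, norm_one]
      exact one_div_le_one_div_of_le two_pos (by linarith)
    have h2 := Complex.norm_log_one_add_half_le_self h1
    rw [← sub_eq_add_neg] at h2
    calc _ ≤ ‖L0 p s + Complex.log (1 - 1 / s)‖ := Complex.abs_re_le_norm _
      _ ≤ _ := norm_add_le _ _
      _ ≤ B + 1 := add_le_add (hB s hs) (by linarith)


theorem log_from_exp {r K t : ℝ} (hK : 0 < K) (ht : 0 ≤ t) (h : Real.exp r ≤ K * (1 + t)) :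
    r ≤ (|Real.log K| + 1) * (1 + Real.log (1 + t)) := by
  have h1 := (Real.le_log_iff_exp_le (by positivity)).2 h
  rw [Real.log_mul hK.ne' (by positivity)] at h1
  have h2 : 0 ≤ Real.log (1 + t) := Real.log_nonneg (by linarith)
  have h3 := le_abs_self (Real.log K)
  nlinarith [abs_nonneg (Real.log K)]

theorem exp_from_log {r ε C t : ℝ} (ht : 0 ≤ t) (h : r ≤ ε * Real.log (1 + t) + C) :
    Real.exp r ≤ Real.exp C * (1 + t) ^ ε := by
  calc Real.exp r ≤ Real.exp (ε * Real.log (1 + t) + C) := Real.exp_le_exp.2 h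
    _ = _ := by rw [Real.exp_add, Real.rpow_def_of_pos (by linarith), mul_comm, mul_comm ε]

theorem shift_bigO {f : ℝ → ℝ} {κ : ℝ} (hκ : 0 ≤ κ) (h : f =O[atTop] fun x : ℝ => x ^ κ) (c : ℝ) :
    (fun x => f (x + c)) =O[atTop] fun x : ℝ => x ^ κ := by
  have h1 := h.comp_tendsto (tendsto_atTop_add_const_right atTop c tendsto_id)
  refine h1.trans (IsBigO.of_bound (2 ^ κ) ?_)
  filter_upwards [eventually_ge_atTop (|c| + 1)] with x hx
  have h2 := abs_le.1 (le_refl |c|)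
  have hx0 : 0 < x := by linarith [abs_nonneg c]
  have hxc : 0 ≤ x + c := by linarith
  simp only [Function.comp, id]
  rw [Real.norm_eq_abs, Real.norm_eq_abs, abs_of_nonneg (by positivity), abs_of_nonneg (by positivity),
    ← Real.mul_rpow (by norm_num) hx0.le]
  exact Real.rpow_le_rpow hxc (by linarith) hκ

theorem rpow_bigO {a b : ℝ} (h : a ≤ b) : (fun x : ℝ => x ^ a) =O[atTop] fun x : ℝ => x ^ b := by
  refine IsBigO.of_bound 1 ?_
  filter_upwards [eventually_ge_atTop 1] with x hx
  rw [Real.norm_eq_abs, Real.norm_eq_abs, abs_of_nonneg (by positivity), abs_of_nonneg (by positivity), one_mul]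
  exact Real.rpow_le_rpow_of_exponent_le hx h

theorem const_bigO (c : ℝ) {b : ℝ} (h : 0 ≤ b) : (fun _ : ℝ => c) =O[atTop] fun x : ℝ => x ^ b := by
  refine (IsBigO.of_bound |c| ?_).trans (rpow_bigO h)
  filter_upwards with x
  simp

section
variable {p : ℕ → ℝ}

theorem NP_mono (hmono : Monotone p) (hp0 : 1 < p 0) (htop : Tendsto p atTop atTop) :
    Monotone (fun x => (NP p x : ℝ)) :=
  step_mono (n := gE p) (w := fun _ => 1) (fun _ => zero_le_one) (NP_hasSum hmono hp0 htop)

theorem NP_zero (hmono : Monotone p) (hp0 : 1 < p 0) (htop : Tendsto p atTop atTop) :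
    ∀ x < 1, (fun x => (NP p x : ℝ)) x = 0 :=
  hasSum_zero_lt (n := gE p) (w := fun _ => 1) (gE_ge (p_gt hmono hp0)) (NP_hasSum hmono hp0 htop)

theorem MP_zero (hmono : Monotone p) (hp0 : 1 < p 0) (htop : Tendsto p atTop atTop) :
    ∀ x < 1, MP p x = 0 :=
  hasSum_zero_lt (n := gS p) (gS_ge (p_gt hmono hp0)) (MP_hasSum hmono hp0 htop)

theorem MP_abs_le (hmono : Monotone p) (hp0 : 1 < p 0) (htop : Tendsto p atTop atTop) (x : ℝ) (hx : 1 ≤ x) :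
    |MP p x| ≤ |(NP p x : ℝ)| := by
  have h := MP_sub_le hmono hp0 htop (x := 0) (y := x) (by linarith)
  have h1 := NP_zero hmono hp0 htop 0 one_pos
  simp only at h1
  rw [MP_zero hmono hp0 htop 0 one_pos, h1, sub_zero, sub_zero] at h
  exact h.trans (le_abs_self _)

theorem MP_meas (hmono : Monotone p) (hp0 : 1 < p 0) (htop : Tendsto p atTop atTop) :
    Measurable (MP p) := by
  have h1 : Monotone (fun x => MP p x + NP p x) := by
    intro x y hxy
    have := (abs_le.1 (MP_sub_le hmono hp0 htop hxy)).1
    simp only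
    linarith
  have h2 := h1.measurable.sub (NP_mono hmono hp0 htop).measurable
  have h3 : MP p = (fun x => MP p x + (NP p x : ℝ)) - fun x => (NP p x : ℝ) := by
    funext x; simp
  rw [h3]; exact h2

theorem dir1 (hmono : Monotone p) (hp0 : 1 < p 0) (htop : Tendsto p atTop atTop) {ρ : ℝ} (hρ : 0 < ρ)
    {θψ θN κ : ℝ}
    (hψ : (fun x => psiP p x - x) =O[atTop] fun x : ℝ => x ^ θψ)
    (hN : (fun x => (NP p x : ℝ) - ρ * x) =O[atTop] fun x : ℝ => x ^ θN)
    (h1 : θψ < κ) (h2 : θN < κ) (hκ : 0 < κ) (hκ1 : κ < 1) :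
    (fun x => MP p x) =O[atTop] fun x : ℝ => x ^ κ := by
  obtain ⟨δ0, hδa, hδκ⟩ := exists_between (max_lt (max_lt h1 h2) hκ)
  obtain ⟨⟨hδψ, hδN⟩, hδ0⟩ : (θψ < δ0 ∧ θN < δ0) ∧ 0 < δ0 := by
    rwa [max_lt_iff, max_lt_iff] at hδa
  obtain ⟨δ1, hδ01, hδ1κ⟩ := exists_between hδκ
  have hNm := NP_mono hmono hp0 htop
  obtain ⟨C0, hNb, hRm, hR0, hRb, hRO, hmel⟩ := rem_pack hNm (NP_zero hmono hp0 htop) hN (by linarith)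
  obtain ⟨hRd, C1, hC1, hRC⟩ := rem_diff hRm hR0 hRb hRO hδN
  obtain ⟨L, hL, hLN, hLM, B, hB⟩ := core hmono hp0 htop (fun x hx => (le_abs_self _).trans (hNb x hx)) hψ
    (by linarith) hδψ hδ0 (by linarith)
  have hLN' : ∀ s : ℂ, δ0 < s.re → Complex.exp (L s) =
      ρ + (s - 1) * mellin (fun x => (remF (fun x => (NP p x : ℝ)) ρ x : ℂ)) (-s) := by
    refine ident hL.cexp (((differentiableOn_id.sub_const 1).mul hRd).const_add _) fun s hs => ?_
    have hs1 : s - 1 ≠ 0 := by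
      intro h
      have := congrArg Complex.re h
      simp at this; linarith
    have := hmel s hs
    rw [hLN s hs, this]
    field_simp
    ring
  set K := ρ + 7 * C1 with hK
  have hup : ∀ s : ℂ, δ0 < s.re → s.re < 6 → 1 ≤ |s.im| →
      (L s).re ≤ (|Real.log K| + 1) * (1 + Real.log (1 + |s.im|)) := by
    intro s hs hs6 _
    refine log_from_exp (by positivity) (abs_nonneg _) ?_
    rw [← Complex.norm_exp, hLN' s hs]
    have e1 : ‖s - 1‖ ≤ 7 * (1 + |s.im|) := by
      have := Complex.norm_le_abs_re_add_abs_im (s - 1)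
      simp only [Complex.sub_re, Complex.one_re, Complex.sub_im, Complex.one_im, sub_zero] at this
      have h3 : |s.re - 1| ≤ 7 := abs_le.2 ⟨by linarith, by linarith⟩
      linarith [abs_nonneg s.im]
    calc _ ≤ ‖(ρ : ℂ)‖ + ‖s - 1‖ * C1 := by
          refine (norm_add_le _ _).trans ?_
          rw [norm_mul]
          gcongr
          exact hRC s hs
      _ ≤ ρ * (1 + |s.im|) + (7 * (1 + |s.im|)) * C1 := by
          rw [Complex.norm_real, Real.norm_eq_abs, abs_of_pos hρ]
          gcongr
          nlinarith [abs_nonneg s.im]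
      _ = _ := by rw [hK]; ring
  set η := κ - δ1 with hη
  have hη0 : 0 < η := by linarith
  obtain ⟨C', hC'⟩ := littlewood hδ0 hδ01 (by linarith) hL hup (fun s h3 _ => hB s h3) (half_pos hη0)
  have hMm := MP_meas hmono hp0 htop
  have hMb : ∀ x, 1 ≤ x → |MP p x| ≤ C0 * x := fun x hx =>
    (MP_abs_le hmono hp0 htop x hx).trans (hNb x hx)
  have hs0 : ∀ s : ℂ, 0 < s.re → s ≠ 0 := by
    rintro s hs rfl; simp at hs
  set Q := (1 + 1 / δ1) with hQ
  have hδ1p : 0 < δ1 := by linarith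
  have hper := perron (a0 := δ0) (a := δ1) (ε := η / 2) (η := η) (C := Q * Q * Real.exp C')
    (G := fun s => (s - 1) / s ^ 2 * Complex.exp (-L s)) hMm (MP_zero hmono hp0 htop) hMb
    hδ0 hδ01 (by linarith) (half_pos hη0) (by linarith) (by linarith) ?_ ?_ ?_
  · have hκe : δ1 + η = κ := by rw [hη]; ring
    rw [hκe] at hper
    have hNκ := hN.trans (rpow_bigO h2.le)
    have hdiff : (fun x => (NP p (x + 1) : ℝ) - NP p x) =O[atTop] fun x : ℝ => x ^ κ := by
      have := ((shift_bigO hκ.le hNκ 1).sub hNκ).add (const_bigO ρ hκ.le)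
      refine this.congr_left fun x => ?_
      ring
    have hrest : (fun x => MP p x - ∫ y in x..x+1, MP p y) =O[atTop] fun x : ℝ => x ^ κ := by
      refine IsBigO.trans (IsBigO.of_bound 1 (Eventually.of_forall fun x => ?_)) hdiff
      have hii := locInt_ii (locInt_of_bound hMm (MP_zero hmono hp0 htop) hMb) x (x + 1)
      have e1 : MP p x - ∫ y in x..x+1, MP p y = ∫ y in x..x+1, (MP p x - MP p y) := by
        rw [intervalIntegral.integral_sub (by simp) hii]
        simp
      rw [e1, one_mul]
      have hle : (NP p x : ℝ) ≤ NP p (x + 1) := hNm (by linarith)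
      rw [Real.norm_eq_abs ((NP p (x + 1) : ℝ) - NP p x), abs_of_nonneg (by linarith)]
      refine (intervalIntegral.norm_integral_le_of_norm_le_const (C := (NP p (x + 1) : ℝ) - NP p x)
        fun y hy => ?_).trans (le_of_eq (by simp))
      rw [Set.uIoc_of_le (by linarith)] at hy
      have h3 := MP_sub_le hmono hp0 htop hy.1.le
      have h4 : (NP p y : ℝ) ≤ NP p (x + 1) := hNm hy.2
      rw [Real.norm_eq_abs, abs_sub_comm]
      linarith
    have := hrest.add hper
    simpa using this
  · intro s hs
    have hs' : δ0 < s.re := hs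
    refine DifferentiableWithinAt.mul ?_ (hL.neg.cexp s hs)
    exact DifferentiableAt.differentiableWithinAt
      (DifferentiableAt.div (by fun_prop) (by fun_prop) (pow_ne_zero 2 (hs0 s (by linarith))))
  · intro s hs
    have := hs0 s (by linarith)
    have h3 := hLM s hs
    field_simp
    rw [h3]
  · intro s hs hs2
    have h3 := exp_from_log (abs_nonneg s.im) ((neg_le_abs _).trans (hC' s hs hs2))
    have hsn : δ1 ≤ ‖s‖ := hs.trans (Complex.re_le_norm s)
    have hsp : 0 < ‖s‖ := by linarith
    have h1s : 1 ≤ 1 / δ1 * ‖s‖ := by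
      rw [div_mul_eq_mul_div, one_mul, le_div_iff₀ hδ1p]; linarith
    have h4 : 1 + |s.im| ≤ Q * ‖s‖ := by
      have := Complex.abs_im_le_norm s
      rw [hQ, add_mul, one_mul]; linarith
    have h5 : ‖s - 1‖ ≤ Q * ‖s‖ := by
      have := norm_sub_le s 1
      rw [norm_one] at this
      rw [hQ, add_mul, one_mul]; linarith
    have ht : 0 < 1 + |s.im| := by positivity
    have hQp : 0 < Q := by positivity
    rw [norm_mul, Complex.norm_exp, norm_div, norm_pow, Complex.neg_re]
    calc ‖s - 1‖ / ‖s‖ ^ 2 * Real.exp (-(L s).re) ≤ (Q * Q / (1 + |s.im|)) * (Real.exp C' * (1 + |s.im|) ^ (η / 2)) := by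
          refine mul_le_mul ?_ h3 (Real.exp_pos _).le (by positivity)
          rw [div_le_div_iff₀ (by positivity) ht]
          calc _ ≤ (Q * ‖s‖) * (Q * ‖s‖) := by gcongr
            _ = _ := by ring
      _ = Q * Q * Real.exp C' * ((1 + |s.im|) ^ (η / 2) / (1 + |s.im|)) := by ring
      _ = _ := by rw [← Real.rpow_sub_one ht.ne']

end


section
variable {p : ℕ → ℝ}

theorem dir2 (hmono : Monotone p) (hp0 : 1 < p 0) (htop : Tendsto p atTop atTop) {ρ : ℝ} (hρ : 0 < ρ)
    {θψ θN θM κ : ℝ}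
    (hψ : (fun x => psiP p x - x) =O[atTop] fun x : ℝ => x ^ θψ)
    (hN : (fun x => (NP p x : ℝ) - ρ * x) =O[atTop] fun x : ℝ => x ^ θN)
    (hM : (fun x => MP p x) =O[atTop] fun x : ℝ => x ^ θM)
    (hθN : θN < 1) (h1 : θψ < κ) (h2 : θM < κ) (hκ : 0 < κ) (hκ1 : κ < 1) :
    (fun x => (NP p x : ℝ) - ρ * x) =O[atTop] fun x : ℝ => x ^ κ := by
  obtain ⟨δ0, hδa, hδκ⟩ := exists_between (max_lt (max_lt h1 h2) hκ)
  obtain ⟨⟨hδψ, hδM⟩, hδ0⟩ : (θψ < δ0 ∧ θM < δ0) ∧ 0 < δ0 := by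
    rwa [max_lt_iff, max_lt_iff] at hδa
  obtain ⟨δ1, hδ01, hδ1κ⟩ := exists_between hδκ
  have hNm := NP_mono hmono hp0 htop
  obtain ⟨C0, hNb, hRm, hR0, hRb, hRO, hmel⟩ := rem_pack hNm (NP_zero hmono hp0 htop) hN hθN
  set R := remF (fun x => (NP p x : ℝ)) ρ with hR
  have hMm := MP_meas hmono hp0 htop
  have hMb : ∀ x, 1 ≤ x → |MP p x| ≤ C0 * x := fun x hx =>
    (MP_abs_le hmono hp0 htop x hx).trans (hNb x hx)
  have hMO : (fun x => (MP p x : ℂ)) =O[atTop] fun x : ℝ => x ^ θM := by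
    refine IsBigO.trans (IsBigO.of_bound 1 (Eventually.of_forall fun x => ?_)) hM
    rw [Complex.norm_real, one_mul]
  obtain ⟨hMd, C1, hC1, hMC⟩ := rem_diff hMm (MP_zero hmono hp0 htop) hMb hMO hδM
  obtain ⟨L, hL, hLN, hLM, B, hB⟩ := core hmono hp0 htop (fun x hx => (le_abs_self _).trans (hNb x hx)) hψ
    (by linarith) hδψ hδ0 (by linarith)
  have hLM' : ∀ s : ℂ, δ0 < s.re → (s - 1) * Complex.exp (-L s) = s ^ 2 * mellin (fun x => (MP p x : ℂ)) (-s) :=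
    ident ((differentiableOn_id.sub_const 1).mul hL.neg.cexp) ((differentiableOn_id.pow 2).mul hMd) hLM
  -- value at one
  have hL1 : Complex.exp (L 1) = ρ := by
    obtain ⟨δ3, h3, h4⟩ := exists_between (max_lt hθN (hδκ.trans hκ1))
    rw [max_lt_iff] at h3
    obtain ⟨hRd, -⟩ := rem_diff hRm hR0 hRb hRO h3.1
    have hLd : DifferentiableOn ℂ L {s | δ3 < s.re} := hL.mono fun s hs => h3.2.trans hs
    have hid : ∀ s : ℂ, δ3 < s.re →
        Complex.exp (L s) = ρ + (s - 1) * mellin (fun x => (R x : ℂ)) (-s) := by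
      refine ident hLd.cexp (((differentiableOn_id.sub_const 1).mul hRd).const_add _) fun s hs => ?_
      have hs1 : s - 1 ≠ 0 := by
        intro h
        have := congrArg Complex.re h
        simp at this; linarith
      have := hmel s hs
      rw [hLN s hs, this]
      field_simp
      ring
    have := hid 1 (by simpa using h4)
    simpa using this
  set K := 72 * C1 + 1 with hK
  have hup : ∀ s : ℂ, δ0 < s.re → s.re < 6 → 1 ≤ |s.im| →
      (-L s).re ≤ (|Real.log K| + 1) * (1 + Real.log (1 + |s.im|)) := by
    intro s hs hs6 him
    refine log_from_exp (by positivity) (abs_nonneg _) ?_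
    have e0 : (1 + |s.im|) / 2 ≤ ‖s - 1‖ := by
      have := Complex.abs_im_le_norm (s - 1)
      simp only [Complex.sub_im, Complex.one_im, sub_zero] at this
      linarith
    have e1 : ‖s‖ ≤ 6 * (1 + |s.im|) := by
      have := Complex.norm_le_abs_re_add_abs_im s
      rw [abs_of_pos (hδ0.trans hs)] at this
      linarith [abs_nonneg s.im]
    have e2 := congrArg norm (hLM' s hs)
    rw [norm_mul, norm_mul, norm_pow] at e2
    have e3 := hMC s hs
    rw [← Complex.norm_exp]
    have e4 : ‖s‖ ^ 2 * ‖mellin (fun x => (MP p x : ℂ)) (-s)‖ ≤ (6 * (1 + |s.im|)) ^ 2 * C1 := by gcongr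
    have e5 : (1 + |s.im|) / 2 * ‖Complex.exp (-L s)‖ ≤ (6 * (1 + |s.im|)) ^ 2 * C1 := by
      refine le_trans ?_ (e2.le.trans e4)
      gcongr
    have ht : 0 < 1 + |s.im| := by positivity
    have e6 : ‖Complex.exp (-L s)‖ ≤ 72 * C1 * (1 + |s.im|) := by
      have : (1 + |s.im|) / 2 * ‖Complex.exp (-L s)‖ ≤ (1 + |s.im|) / 2 * (72 * C1 * (1 + |s.im|)) := by
        refine e5.trans (le_of_eq (by ring))
      exact le_of_mul_le_mul_left this (by positivity)
    rw [hK]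
    linarith
  set η := κ - δ1 with hη
  have hη0 : 0 < η := by linarith
  obtain ⟨C', hC'⟩ := littlewood hδ0 hδ01 (by linarith) hL.neg hup
    (fun s h3 _ => by rw [Pi.neg_apply, Complex.neg_re, abs_neg]; exact hB s h3) (half_pos hη0)
  have hδ1p : 0 < δ1 := by linarith
  have hmem : {s : ℂ | δ0 < s.re} ∈ nhds (1 : ℂ) := (hp_open δ0).mem_nhds (by
    show δ0 < (1 : ℂ).re
    simp; linarith)
  set G : ℂ → ℂ := dslope (fun s => Complex.exp (L s)) 1 with hG
  have hGd : DifferentiableOn ℂ G {s | δ0 < s.re} := (Complex.differentiableOn_dslope hmem).2 hL.cexp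
  have hGne : ∀ s : ℂ, s ≠ 1 → G s = (Complex.exp (L s) - ρ) / (s - 1) := by
    intro s hs
    rw [hG, dslope_of_ne _ hs, slope_def_field, hL1]
  obtain ⟨C2, hC2⟩ : ∃ C2, ∀ s ∈ Set.Icc δ1 2 ×ℂ Set.Icc (-1 : ℝ) 1, ‖G s‖ ≤ C2 := by
    refine (isCompact_Icc.reProdIm isCompact_Icc).exists_bound_of_continuousOn (hGd.continuousOn.mono ?_)
    intro s hs
    rw [Complex.mem_reProdIm] at hs
    exact hδ01.trans_le hs.1.1
  have hper := perron (a0 := δ0) (a := δ1) (ε := η / 2) (η := η)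
    (C := 2 * |C2| + 2 * (Real.exp C' + ρ))
    (G := G) hRm hR0 hRb
    hδ0 hδ01 (by linarith) (half_pos hη0) (by linarith) (by linarith) hGd ?_ ?_
  · have hκe : δ1 + η = κ := by rw [hη]; ring
    rw [hκe] at hper
    have hii : ∀ x, IntervalIntegrable R MeasureTheory.volume x (x + 1) := fun x =>
      locInt_ii (locInt_of_bound hRm hR0 hRb) x (x + 1)
    have hNint : ∀ x, IntervalIntegrable (fun x => (NP p x : ℝ)) MeasureTheory.volume x (x + 1) := fun x =>
      hNm.intervalIntegrable
    have hI : ∀ x, 1 ≤ x → ∫ y in x..x+1, R y = (∫ y in x..x+1, (NP p y : ℝ)) - ρ * (x + 1 / 2) := by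
      intro x hx
      have e1 : ∫ y in x..x+1, R y = ∫ y in x..x+1, ((NP p y : ℝ) - ρ * y) := by
        refine intervalIntegral.integral_congr fun y hy => ?_
        rw [Set.uIcc_of_le (by linarith)] at hy
        simp only [hR, remF]
        rw [if_pos (by linarith [hy.1])]
      rw [e1, intervalIntegral.integral_sub (hNint x) (by apply Continuous.intervalIntegrable; fun_prop),
        intervalIntegral.integral_const_mul, integral_id]
      ring
    have hlo : ∀ x, (NP p x : ℝ) ≤ ∫ y in x..x+1, (NP p y : ℝ) := by
      intro x
      have := intervalIntegral.integral_mono_on (a := x) (b := x + 1) (f := fun _ => (NP p x : ℝ))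
        (by linarith) (by simp) (hNint x) (fun y hy => hNm hy.1)
      simpa using this
    have hhi : ∀ x, ∫ y in x..x+1, (NP p y : ℝ) ≤ (NP p (x + 1) : ℝ) := by
      intro x
      have := intervalIntegral.integral_mono_on (a := x) (b := x + 1) (g := fun _ => (NP p (x + 1) : ℝ))
        (by linarith) (hNint x) (by simp) (fun y hy => hNm hy.2)
      simpa using this
    have hper2 := shift_bigO hκ.le hper (-1)
    have hsum := (hper.norm_left.add hper2.norm_left).add (const_bigO ρ hκ.le)
    refine IsBigO.trans (IsBigO.of_bound 1 ?_) hsum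
    filter_upwards [eventually_ge_atTop 2] with x hx
    have a1 := hI x (by linarith)
    have a2 := hI (x + -1) (by linarith)
    have a3 := hlo x
    have a4 := hhi (x + -1)
    have e : x + -1 + 1 = x := by ring
    rw [e] at a2 a4 ⊢
    have b1 := abs_le.1 (le_refl |∫ y in x..x+1, R y|)
    have b2 := abs_le.1 (le_refl |∫ y in (x + -1)..x, R y|)
    rw [one_mul]
    simp only [Real.norm_eq_abs]
    have c1 := abs_nonneg (∫ y in x..x+1, R y)
    have c2 := abs_nonneg (∫ y in (x + -1)..x, R y)
    refine le_trans ?_ (le_abs_self _)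
    rw [abs_le]
    constructor <;> nlinarith
  · intro s hs
    have hs1 : s ≠ 1 := by
      rintro rfl; simp at hs
    have hs2 : s - 1 ≠ 0 := sub_ne_zero.2 hs1
    have := hmel s hs
    rw [hGne s hs1, hLN s hs, this]
    field_simp
    ring
  · intro s hs hs2
    have ht : 0 < 1 + |s.im| := by positivity
    rcases le_total |s.im| 1 with him | him
    · have h3 := hC2 s (by
        rw [Complex.mem_reProdIm]
        exact ⟨⟨hs, hs2⟩, abs_le.1 him⟩)
      have h4 : (1:ℝ) ≤ 2 * (1 + |s.im|) ^ (η / 2 - 1) := by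
        have h5 : (1 + |s.im|) ^ (-1 : ℝ) ≤ (1 + |s.im|) ^ (η / 2 - 1) :=
          Real.rpow_le_rpow_of_exponent_le (by linarith [abs_nonneg s.im]) (by linarith)
        have h6 : (1 / 2 : ℝ) ≤ (1 + |s.im|) ^ (-1 : ℝ) := by
          rw [Real.rpow_neg_one, one_div]
          exact inv_anti₀ ht (by linarith)
        linarith
      have h7 : 0 ≤ Real.exp C' + ρ := by positivity
      calc ‖G s‖ ≤ |C2| * 1 := by rw [mul_one]; exact h3.trans (le_abs_self _)
        _ ≤ |C2| * (2 * (1 + |s.im|) ^ (η / 2 - 1)) := by gcongr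
        _ = (2 * |C2|) * (1 + |s.im|) ^ (η / 2 - 1) := by ring
        _ ≤ _ := by
          gcongr
          linarith
    · have hs1 : s ≠ 1 := by
        rintro rfl
        norm_num at him
      have h8 := hC' s hs hs2
      rw [Pi.neg_apply, Complex.neg_re, abs_neg] at h8
      have h3 := exp_from_log (abs_nonneg s.im) ((le_abs_self _).trans h8)
      have e0 : (1 + |s.im|) / 2 ≤ ‖s - 1‖ := by
        have := Complex.abs_im_le_norm (s - 1)
        simp only [Complex.sub_im, Complex.one_im, sub_zero] at this
        linarith
      have h9 : (1:ℝ) ≤ (1 + |s.im|) ^ (η / 2) := Real.one_le_rpow (by linarith) (by linarith)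
      rw [hGne s hs1, norm_div]
      calc _ ≤ ((Real.exp C' + ρ) * (1 + |s.im|) ^ (η / 2)) / ((1 + |s.im|) / 2) := by
            refine div_le_div₀ (by positivity) ?_ (by positivity) e0
            refine (norm_sub_le _ _).trans ?_
            rw [Complex.norm_exp, Complex.norm_real, Real.norm_eq_abs, abs_of_pos hρ]
            nlinarith
        _ = 2 * (Real.exp C' + ρ) * ((1 + |s.im|) ^ (η / 2) / (1 + |s.im|)) := by field_simp
        _ = (2 * (Real.exp C' + ρ)) * (1 + |s.im|) ^ (η / 2 - 1) := by rw [← Real.rpow_sub_one ht.ne']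
        _ ≤ _ := by
          gcongr
          linarith [abs_nonneg C2]

theorem psi_nonneg (hmono : Monotone p) (hp0 : 1 < p 0) (htop : Tendsto p atTop atTop) {θ : ℝ}
    (hψ : (fun x => psiP p x - x) =O[atTop] fun x : ℝ => x ^ θ) : 0 ≤ θ := by
  by_contra! hθ
  have hp := p_gt hmono hp0
  have h1 : Tendsto (fun x => psiP p x - x) atTop (nhds 0) := by
    refine hψ.trans_tendsto ?_
    have := tendsto_rpow_neg_atTop (y := -θ) (by linarith)
    simpa using this
  set l := Real.log (p 0) with hl
  have hl0 : 0 < l := Real.log_pos hp0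
  have h2 := h1.comp htop
  have h3 := h1.comp (tendsto_atTop_add_const_right atTop (-(l / 2)) htop)
  have h4 := h2.sub h3
  rw [sub_zero] at h4
  obtain ⟨i, hi⟩ := (h4.eventually (gt_mem_nhds (half_pos hl0))).exists
  simp only [Function.comp] at hi
  have hA := (psiP_hasSum hmono hp0 htop (p i)).sub (psiP_hasSum hmono hp0 htop (p i + -(l / 2)))
  have h5 := sum_le_hasSum {(i, 0)} (fun ik _ => ?_) hA
  · rw [Finset.sum_singleton] at h5
    simp only [zero_add, pow_one, le_refl, if_true] at h5
    rw [if_neg (by linarith)] at h5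
    have h6 : l ≤ Real.log (p i) := Real.log_le_log (by linarith) (hmono (Nat.zero_le i))
    linarith
  · have h7 : 0 ≤ Real.log (p ik.1) := Real.log_nonneg (hp ik.1).le
    by_cases h : p ik.1 ^ (ik.2 + 1) ≤ p i + -(l / 2)
    · rw [if_pos h, if_pos (by linarith)]; simp
    · rw [if_neg h, sub_zero]; split_ifs <;> simp [h7]

end

theorem stmt3 (p : ℕ → ℝ) (hmono : Monotone p) (hp0 : 1 < p 0)
    (htop : Tendsto p atTop atTop) (ρ : ℝ) (hρ : 0 < ρ)
    (Sψ SN : Set ℝ)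
    (hSψ : Sψ = {θ : ℝ | (fun x => psiP p x - x) =O[atTop] fun x => x ^ θ})
    (hSN : SN = {θ : ℝ | (fun x => (NP p x : ℝ) - ρ * x) =O[atTop] fun x => x ^ θ})
    (hψne : Sψ.Nonempty) (hNne : SN.Nonempty)
    (α β : ℝ) (hα : α = sInf Sψ) (hβ : β = sInf SN)
    (hαβ : α < β) (hβ1 : β < 1) :
    {θ : ℝ | (fun x => MP p x) =O[atTop] fun x => x ^ θ}.Nonempty ∧
    sInf {θ : ℝ | (fun x => MP p x) =O[atTop] fun x => x ^ θ} = β := by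

  have hα0 : 0 ≤ α := by
    rw [hα]
    refine Real.sInf_nonneg fun θ hθ => ?_
    rw [hSψ] at hθ
    exact psi_nonneg hmono hp0 htop hθ
  obtain ⟨θψ, hθψ, hθψβ⟩ : ∃ θ ∈ Sψ, θ < β := exists_lt_of_csInf_lt hψne (hα ▸ hαβ)
  rw [hSψ] at hθψ
  have hmem1 : ∀ κ, β < κ → κ < 1 → (fun x => MP p x) =O[atTop] fun x : ℝ => x ^ κ := by
    intro κ hκ hκ1
    obtain ⟨θN, hθN, hθNκ⟩ : ∃ θ ∈ SN, θ < κ := exists_lt_of_csInf_lt hNne (hβ ▸ hκ)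
    rw [hSN] at hθN
    exact dir1 hmono hp0 htop hρ hθψ hθN (by linarith) hθNκ (by linarith) hκ1
  have hlow : ∀ θ, ((fun x => MP p x) =O[atTop] fun x : ℝ => x ^ θ) → β ≤ θ := by
    intro θM hθM
    by_contra! hlt
    obtain ⟨θN, hθN, hθN1⟩ : ∃ θ ∈ SN, θ < 1 := exists_lt_of_csInf_lt hNne (hβ ▸ hβ1)
    rw [hSN] at hθN
    obtain ⟨κ, h1, h2⟩ := exists_between (max_lt (max_lt hθψβ hlt) (hα0.trans_lt hαβ))
    rw [max_lt_iff, max_lt_iff] at h1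
    have h3 := dir2 hmono hp0 htop hρ hθψ hθN hθM hθN1 h1.1.1 h1.1.2 h1.2 (by linarith)
    have hbdd : BddBelow SN := by
      by_contra hb
      have := Real.sInf_of_not_bddBelow hb
      linarith
    have h4 : sInf SN ≤ κ := csInf_le hbdd (by rw [hSN]; exact h3)
    linarith
  have hne : {θ : ℝ | (fun x => MP p x) =O[atTop] fun x => x ^ θ}.Nonempty := by
    obtain ⟨κ, h1, h2⟩ := exists_between hβ1
    exact ⟨κ, hmem1 κ h1 h2⟩
  refine ⟨hne, le_antisymm ?_ (le_csInf hne hlow)⟩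
  refine le_of_forall_gt_imp_ge_of_dense fun κ hκ => ?_
  obtain ⟨κ', h1, h2⟩ := exists_between (lt_min hκ hβ1)
  rw [lt_min_iff] at h2
  exact (csInf_le ⟨β, hlow⟩ (hmem1 κ' h1 h2.2)).trans h2.1.le
end

section
/- Let b : ℕ → ℝ be strictly increasing with b 0 ≥ 1 and b n → ∞, let a : ℕ → ℂ, and set A(x) = Σ_{n : b n ≤ x} a n. Suppose α ∈ [0,1) and c ∈ ℂ are such that for every ε > 0, A(x) = c·x + O(x^{α+ε}) as x → ∞. Then there exists a function F, holomorphic on {s ∈ ℂ : Re s > α} ∖ {1}, such that: (i) for every s with Re s > 1 the series Σ_n a n · (b n)^{−s} converges and equals F(s); (ii) (s − 1)·F(s) → c as s → 1; and (iii) for every δ > 0 and ε > 0 there is a constant C such that |F(σ + it)| ≤ C·|t|^{1+ε} for all σ ≥ α + δ and all real t with |t| ≥ 1. -/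
open Filter Asymptotics

/-- Summatory function A(x) = Σ_{n : b n ≤ x} a n (a finite sum for each x). -/
noncomputable def Asum (b : ℕ → ℝ) (a : ℕ → ℂ) (x : ℝ) : ℂ :=
  ∑ᶠ n ∈ {n : ℕ | b n ≤ x}, a n

open MeasureTheory

/-- Truncated summatory function. -/
noncomputable def AN (b : ℕ → ℝ) (a : ℕ → ℂ) (N : ℕ) (x : ℝ) : ℂ :=
  ∑ n ∈ Finset.range N, if b n ≤ x then a n else 0

lemma Asum_eq_AN {b : ℕ → ℝ} (hb : StrictMono b) (a : ℕ → ℂ) {N : ℕ} {x : ℝ} (h : x < b N) :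
    Asum b a x = AN b a N x := by
  unfold Asum AN
  rw [← Finset.sum_filter]
  rw [← finsum_mem_coe_finset]
  refine finsum_mem_congr (Set.ext fun n => ?_) fun _ _ => rfl
  have : b n ≤ x → n < N := fun hn => hb.lt_iff_lt.1 (hn.trans_lt h)
  simp
  tauto

lemma AN_succ_eq {b : ℕ → ℝ} (hb : StrictMono b) (a : ℕ → ℂ) {N : ℕ} {x : ℝ} (h : b N ≤ x) :
    AN b a (N + 1) x = Asum b a (b N) := by
  rw [Asum_eq_AN hb a (hb (Nat.lt_succ_self N))]
  unfold AN
  refine Finset.sum_congr rfl fun n hn => ?_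
  have h1 : b n ≤ b N := hb.monotone (Nat.lt_succ_iff.1 (Finset.mem_range.1 hn))
  rw [if_pos h1, if_pos (h1.trans h)]

lemma AN_measurable (b : ℕ → ℝ) (a : ℕ → ℂ) (N : ℕ) : Measurable (AN b a N) := by
  unfold AN
  refine Finset.measurable_sum _ fun n _ => ?_
  exact Measurable.ite measurableSet_Ici measurable_const measurable_const

lemma AN_tendsto {b : ℕ → ℝ} (hb : StrictMono b) (hbtop : Tendsto b atTop atTop)
    (a : ℕ → ℂ) (x : ℝ) : Tendsto (fun N => AN b a N x) atTop (nhds (Asum b a x)) := by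
  refine tendsto_const_nhds.congr' ?_
  filter_upwards [hbtop.eventually_gt_atTop x] with N hN
  exact Asum_eq_AN hb a hN

lemma Asum_measurable {b : ℕ → ℝ} (hb : StrictMono b) (hbtop : Tendsto b atTop atTop)
    (a : ℕ → ℂ) : Measurable (Asum b a) :=
  measurable_of_tendsto_metrizable (AN_measurable b a)
    (tendsto_pi_nhds.2 fun x => AN_tendsto hb hbtop a x)

lemma Asum_bdd {b : ℕ → ℝ} (hb : StrictMono b) (hbtop : Tendsto b atTop atTop)
    (a : ℕ → ℂ) (X : ℝ) : ∃ K : ℝ, 0 ≤ K ∧ ∀ x ≤ X, ‖Asum b a x‖ ≤ K := by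
  obtain ⟨N, hN⟩ := (hbtop.eventually_gt_atTop X).exists
  refine ⟨∑ n ∈ Finset.range N, ‖a n‖, by positivity, fun x hx => ?_⟩
  rw [Asum_eq_AN hb a (hx.trans_lt hN)]
  refine (norm_sum_le _ _).trans (Finset.sum_le_sum fun n _ => ?_)
  split_ifs <;> simp

lemma E_bound {b : ℕ → ℝ} (hb : StrictMono b) (hbtop : Tendsto b atTop atTop)
    (a : ℕ → ℂ) (c : ℂ) (β : ℝ) (hβ : 0 ≤ β)
    (hA : (fun x : ℝ => Asum b a x - c * x) =O[atTop] fun x => x ^ β) :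
    ∃ K : ℝ, 0 ≤ K ∧ ∀ x : ℝ, 1 ≤ x → ‖Asum b a x - c * x‖ ≤ K * x ^ β := by
  obtain ⟨K, hK, h⟩ := hA.exists_pos
  rw [IsBigOWith, eventually_atTop] at h
  obtain ⟨X, hX⟩ := h
  obtain ⟨L, hL, hL'⟩ := Asum_bdd hb hbtop a X
  refine ⟨K + L + ‖c‖ * |X|, by positivity, fun x hx => ?_⟩
  have h1 : 1 ≤ x ^ β := Real.one_le_rpow hx hβ
  have h0 : 0 ≤ L + ‖c‖ * |X| := by positivity
  rcases le_total X x with hh | hh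
  · have := hX x hh
    rw [Real.norm_of_nonneg (by linarith : 0 ≤ x ^ β)] at this
    nlinarith
  · have h2 := hL' x hh
    have h3 : ‖c * (x:ℂ)‖ ≤ ‖c‖ * |X| := by
      rw [norm_mul, Complex.norm_real, Real.norm_eq_abs]
      gcongr
    have := norm_sub_le (Asum b a x) (c * x)
    nlinarith

/-- The error term, cut off below `1`. -/
noncomputable def Eg (b : ℕ → ℝ) (a : ℕ → ℂ) (c : ℂ) : ℝ → ℂ :=
  (Set.Ioi (1:ℝ)).indicator fun x => Asum b a x - c * x

lemma Eg_bound {b : ℕ → ℝ} {a : ℕ → ℂ} {c : ℂ} {β K : ℝ} (hK : 0 ≤ K)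
    (h : ∀ x : ℝ, 1 ≤ x → ‖Asum b a x - c * x‖ ≤ K * x ^ β) {x : ℝ} (hx : 0 ≤ x) :
    ‖Eg b a c x‖ ≤ K * x ^ β := by
  unfold Eg Set.indicator
  split_ifs with h1
  · exact h x (le_of_lt h1)
  · simp; positivity

lemma Eg_measurable {b : ℕ → ℝ} (hb : StrictMono b) (hbtop : Tendsto b atTop atTop)
    (a : ℕ → ℂ) (c : ℂ) : Measurable (Eg b a c) := by
  refine Measurable.indicator ?_ measurableSet_Ioi
  exact (Asum_measurable hb hbtop a).sub (by fun_prop)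

lemma Eg_locInt {b : ℕ → ℝ} (hb : StrictMono b) (hbtop : Tendsto b atTop atTop)
    (a : ℕ → ℂ) (c : ℂ) {β K : ℝ} (hβ : 0 ≤ β) (hK : 0 ≤ K)
    (h : ∀ x : ℝ, 1 ≤ x → ‖Asum b a x - c * x‖ ≤ K * x ^ β) :
    LocallyIntegrableOn (Eg b a c) (Set.Ioi 0) := by
  have hc : ContinuousOn (fun x : ℝ => K * x ^ β) (Set.Ioi 0) :=
    (continuous_const.mul (Real.continuous_rpow_const hβ)).continuousOn
  have := hc.locallyIntegrableOn (μ := volume) measurableSet_Ioi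
  intro x hx
  obtain ⟨U, hU, hU'⟩ := this x hx
  refine ⟨U ∩ Set.Ioi 0, inter_mem hU self_mem_nhdsWithin, ?_⟩
  refine Integrable.mono' (hU'.mono_set Set.inter_subset_left)
    (Eg_measurable hb hbtop a c).aestronglyMeasurable ?_
  refine ae_restrict_of_ae_restrict_of_subset Set.inter_subset_right ?_
  refine (ae_restrict_iff' measurableSet_Ioi).2 (ae_of_all _ fun y hy => ?_)
  exact Eg_bound hK h (le_of_lt hy)

lemma Eg_top {b : ℕ → ℝ} {a : ℕ → ℂ} {c : ℂ} {β K : ℝ} (hK : 0 ≤ K)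
    (h : ∀ x : ℝ, 1 ≤ x → ‖Asum b a x - c * x‖ ≤ K * x ^ β) :
    Eg b a c =O[atTop] fun x => x ^ (-(-β)) := by
  refine IsBigO.of_bound K ?_
  filter_upwards [eventually_ge_atTop 0] with x hx
  rw [neg_neg, Real.norm_of_nonneg (by positivity : 0 ≤ x ^ β)]
  exact Eg_bound hK h hx

lemma Eg_zero (b : ℕ → ℝ) (a : ℕ → ℂ) (c : ℂ) (r : ℝ) :
    Eg b a c =O[nhdsWithin 0 (Set.Ioi 0)] fun x => x ^ (-r) := by
  refine IsBigO.of_bound 1 ?_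
  filter_upwards [mem_nhdsWithin_of_mem_nhds (Iio_mem_nhds (zero_lt_one (α := ℝ)))] with x hx
  have : x ∉ Set.Ioi (1:ℝ) := by simpa using le_of_lt hx
  simp [Eg, Set.indicator_of_notMem this]

lemma mellin_bound {b : ℕ → ℝ} {a : ℕ → ℂ} {c : ℂ} {β K : ℝ} (hK : 0 ≤ K)
    (h : ∀ x : ℝ, 1 ≤ x → ‖Asum b a x - c * x‖ ≤ K * x ^ β) {s : ℂ} (hs : β < s.re) :
    ‖mellin (Eg b a c) (-s)‖ ≤ K / (s.re - β) := by
  have hint : IntegrableOn (fun x : ℝ => K * x ^ (β - s.re - 1)) (Set.Ioi 1) :=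
    (integrableOn_Ioi_rpow_of_lt (by linarith) one_pos).const_mul K
  have hval : ∫ x in Set.Ioi (1:ℝ), K * x ^ (β - s.re - 1) = K / (s.re - β) := by
    rw [integral_const_mul, integral_Ioi_rpow_of_lt (by linarith) one_pos]
    have : s.re - β ≠ 0 := by linarith
    have : β - s.re ≠ 0 := by linarith
    simp
    rw [← neg_sub s.re β]; field_simp
  rw [← hval]
  have : mellin (Eg b a c) (-s) = ∫ x in Set.Ioi (1:ℝ), (x:ℂ) ^ (-s - 1) • (Asum b a x - c * x) := by
    unfold mellin
    rw [← integral_indicator measurableSet_Ioi, ← integral_indicator measurableSet_Ioi]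
    congr 1
    ext x
    unfold Eg
    by_cases h1 : x ∈ Set.Ioi (1:ℝ)
    · have h0 : x ∈ Set.Ioi (0:ℝ) := Set.mem_Ioi.2 (lt_trans one_pos (Set.mem_Ioi.1 h1))
      simp [Set.indicator_of_mem h1, Set.indicator_of_mem h0]
    · simp [Set.indicator_of_notMem h1, Set.indicator]
      intro _ h2
      exact absurd h2 h1
  rw [this]
  refine norm_integral_le_of_norm_le hint ?_
  refine (ae_restrict_iff' measurableSet_Ioi).2 (ae_of_all _ fun x hx => ?_)
  have hx0 : 0 < x := lt_trans one_pos hx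
  rw [norm_smul, Complex.norm_cpow_eq_rpow_re_of_pos hx0]
  have e : x ^ (β - s.re - 1) = x ^ (-s - 1).re * x ^ β := by
    rw [← Real.rpow_add hx0]; congr 1; simp; ring
  rw [e]
  have := h x (le_of_lt hx)
  calc _ ≤ x ^ (-s - 1).re * (K * x ^ β) := by gcongr
    _ = _ := by ring

lemma mellin_eq {b : ℕ → ℝ} (a : ℕ → ℂ) (c : ℂ) (s : ℂ) :
    mellin (Eg b a c) (-s) = ∫ x in Set.Ioi (1:ℝ), (x:ℂ) ^ (-s - 1) * (Asum b a x - c * x) := by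
  unfold mellin
  rw [← integral_indicator measurableSet_Ioi, ← integral_indicator measurableSet_Ioi]
  congr 1
  ext x
  unfold Eg
  by_cases h1 : x ∈ Set.Ioi (1:ℝ)
  · have h0 : x ∈ Set.Ioi (0:ℝ) := Set.mem_Ioi.2 (lt_trans one_pos (Set.mem_Ioi.1 h1))
    simp [Set.indicator_of_mem h1, Set.indicator_of_mem h0]
  · simp [Set.indicator_of_notMem h1, Set.indicator]
    intro _ h2
    exact absurd h2 h1

lemma partial_eq {b : ℕ → ℝ} (hb1 : ∀ n, 1 ≤ b n) (a : ℕ → ℂ) {s : ℂ} (hs : 1 < s.re) (N : ℕ) :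
    ∑ n ∈ Finset.range N, a n * (b n : ℂ) ^ (-s) =
      s * ∫ x in Set.Ioi (1:ℝ), (x:ℂ) ^ (-s - 1) * AN b a N x := by
  have hs0 : s ≠ 0 := by rintro rfl; simp at hs; linarith
  have hre : (-s - 1).re < -1 := by simp; linarith
  have key : ∀ n, (fun x : ℝ => (x:ℂ) ^ (-s - 1) * (if b n ≤ x then a n else 0)) =
      (Set.Ici (b n)).indicator (fun x : ℝ => (x:ℂ) ^ (-s - 1) * a n) := by
    intro n; ext x; simp [Set.indicator]
  have hint : ∀ n, IntegrableOn (fun x : ℝ => (x:ℂ) ^ (-s - 1) * (if b n ≤ x then a n else 0))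
      (Set.Ioi 1) := by
    intro n
    rw [key]
    exact ((integrableOn_Ioi_cpow_of_lt hre one_pos).mul_const _).indicator measurableSet_Ici
  unfold AN
  simp_rw [Finset.mul_sum]
  rw [integral_finsetSum _ fun n _ => hint n, Finset.mul_sum]
  refine Finset.sum_congr rfl fun n _ => ?_
  have hbn : 0 < b n := one_pos.trans_le (hb1 n)
  rw [key, setIntegral_indicator measurableSet_Ici]
  have hset : (Set.Ioi 1 ∩ Set.Ici (b n) : Set ℝ) =ᵐ[volume] Set.Ioi (b n) := by
    have h1 : (Set.Ioi 1 ∩ Set.Ici (b n) : Set ℝ) =ᵐ[volume] (Set.Ioi 1 ∩ Set.Ioi (b n) : Set ℝ) :=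
      (ae_eq_refl _).inter Ioi_ae_eq_Ici.symm
    refine h1.trans (Eq.eventuallyEq ?_)
    exact Set.inter_eq_right.2 (Set.Ioi_subset_Ioi (hb1 n))
  rw [setIntegral_congr_set hset, integral_mul_const, integral_Ioi_cpow_of_lt hre hbn]
  simp
  field_simp

lemma series_tendsto {b : ℕ → ℝ} (hb : StrictMono b) (hb1 : ∀ n, 1 ≤ b n)
    (hbtop : Tendsto b atTop atTop) (a : ℕ → ℂ) (c : ℂ) {β K : ℝ} (hβ : β < 1) (hK : 0 ≤ K)
    (h : ∀ x : ℝ, 1 ≤ x → ‖Asum b a x - c * x‖ ≤ K * x ^ β) {s : ℂ} (hs : 1 < s.re) :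
    Tendsto (fun N => ∑ n ∈ Finset.range N, a n * (b n : ℂ) ^ (-s)) atTop
      (nhds (c * s / (s - 1) + s * mellin (Eg b a c) (-s))) := by
  have hs1 : s - 1 ≠ 0 := by
    intro h0; rw [sub_eq_zero.1 h0] at hs; simp at hs
  have hAb : ∀ x : ℝ, 1 ≤ x → ‖Asum b a x‖ ≤ (K + ‖c‖) * x := by
    intro x hx
    have h1 : x ^ β ≤ x := by
      simpa using Real.rpow_le_rpow_of_exponent_le hx hβ.le
    have h2 := norm_add_le (Asum b a x - c * x) (c * x)
    rw [sub_add_cancel, norm_mul, Complex.norm_real, Real.norm_of_nonneg (by linarith)] at h2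
    have h3 := h x hx
    nlinarith
  have hANb : ∀ N : ℕ, ∀ x : ℝ, 1 ≤ x → ‖AN b a N x‖ ≤ (K + ‖c‖) * x := by
    intro N x hx
    rcases lt_or_ge x (b N) with hlt | hge
    · rw [← Asum_eq_AN hb a hlt]; exact hAb x hx
    · cases N with
      | zero => simp [AN]; positivity
      | succ M =>
        have hM : b M ≤ x := (hb.monotone (Nat.le_succ M)).trans hge
        rw [AN_succ_eq hb a hM]
        refine (hAb _ (hb1 M)).trans ?_
        gcongr
  have hdom : IntegrableOn (fun x : ℝ => (K + ‖c‖) * x ^ (-s.re)) (Set.Ioi 1) :=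
    (integrableOn_Ioi_rpow_of_lt (by linarith) one_pos).const_mul _
  have hcm : Measurable (fun x : ℝ => (x:ℂ) ^ (-s - 1)) := by fun_prop
  have hbd : ∀ x : ℝ, 1 < x → ∀ z : ℂ, ‖z‖ ≤ (K + ‖c‖) * x →
      ‖(x:ℂ) ^ (-s - 1) * z‖ ≤ (K + ‖c‖) * x ^ (-s.re) := by
    intro x hx z hz
    have hx0 : 0 < x := by linarith
    rw [norm_mul, Complex.norm_cpow_eq_rpow_re_of_pos hx0]
    have e : x ^ (-s.re) = x ^ (-s - 1).re * x := by
      rw [← Real.rpow_add_one hx0.ne']; congr 1; simp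
    rw [e]
    calc _ ≤ x ^ (-s - 1).re * ((K + ‖c‖) * x) := by gcongr
      _ = _ := by ring
  have hlim : Tendsto (fun N => ∫ x in Set.Ioi (1:ℝ), (x:ℂ) ^ (-s - 1) * AN b a N x) atTop
      (nhds (∫ x in Set.Ioi (1:ℝ), (x:ℂ) ^ (-s - 1) * Asum b a x)) := by
    refine tendsto_integral_of_dominated_convergence _
      (fun N => (hcm.mul (AN_measurable b a N)).aestronglyMeasurable) hdom (fun N => ?_) ?_
    · refine (ae_restrict_iff' measurableSet_Ioi).2 (ae_of_all _ fun x hx => ?_)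
      exact hbd x hx _ (hANb N x (le_of_lt hx))
    · exact ae_of_all _ fun x => (AN_tendsto hb hbtop a x).const_mul _
  have hintA : IntegrableOn (fun x : ℝ => (x:ℂ) ^ (-s - 1) * Asum b a x) (Set.Ioi 1) := by
    refine Integrable.mono' hdom (hcm.mul (Asum_measurable hb hbtop a)).aestronglyMeasurable ?_
    refine (ae_restrict_iff' measurableSet_Ioi).2 (ae_of_all _ fun x hx => ?_)
    exact hbd x hx _ (hAb x (le_of_lt hx))
  have hcx : Set.EqOn (fun x : ℝ => (x:ℂ) ^ (-s - 1) * (c * x)) (fun x : ℝ => c * (x:ℂ) ^ (-s))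
      (Set.Ioi 1) := by
    intro x hx
    have hx0 : (x:ℂ) ≠ 0 := by exact_mod_cast (lt_trans one_pos hx).ne'
    have : (x:ℂ) ^ (-s) = (x:ℂ) ^ (-s - 1) * x := by
      rw [Complex.cpow_sub _ _ hx0, Complex.cpow_one]; field_simp
    simp only [this]; ring
  have hre : (-s).re < -1 := by simp; linarith
  have hintc : IntegrableOn (fun x : ℝ => (x:ℂ) ^ (-s - 1) * (c * x)) (Set.Ioi 1) :=
    IntegrableOn.congr_fun ((integrableOn_Ioi_cpow_of_lt hre one_pos).const_mul c) hcx.symm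
      measurableSet_Ioi
  have hval : ∫ x in Set.Ioi (1:ℝ), (x:ℂ) ^ (-s - 1) * (c * x) = c / (s - 1) := by
    rw [setIntegral_congr_fun measurableSet_Ioi hcx, integral_const_mul,
      integral_Ioi_cpow_of_lt hre one_pos]
    have : -s + 1 ≠ 0 := by
      rw [show -s + 1 = -(s - 1) by ring]; exact neg_ne_zero.2 hs1
    simp
    rw [show -s + 1 = -(s - 1) by ring]; field_simp
  have hfin : c * s / (s - 1) + s * mellin (Eg b a c) (-s) =
      s * ∫ x in Set.Ioi (1:ℝ), (x:ℂ) ^ (-s - 1) * Asum b a x := by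
    rw [mellin_eq]
    simp_rw [mul_sub]
    rw [integral_sub hintA hintc, hval]
    ring
  rw [hfin]
  simp_rw [partial_eq hb1 a hs]
  exact hlim.const_mul s

theorem stmt4 (b : ℕ → ℝ) (hb : StrictMono b) (hb0 : 1 ≤ b 0)
    (hbtop : Tendsto b atTop atTop) (a : ℕ → ℂ)
    (α : ℝ) (hα : α ∈ Set.Ico (0:ℝ) 1) (c : ℂ)
    (hA : ∀ ε > 0, (fun x : ℝ => Asum b a x - c * x) =O[atTop] fun x => x ^ (α + ε)) :
    ∃ F : ℂ → ℂ, DifferentiableOn ℂ F ({s : ℂ | α < s.re} \ {1}) ∧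
      (∀ s : ℂ, 1 < s.re →
        Tendsto (fun N => ∑ n ∈ Finset.range N, a n * (b n : ℂ) ^ (-s)) atTop (nhds (F s))) ∧
      Tendsto (fun s : ℂ => (s - 1) * F s) (nhdsWithin 1 {(1:ℂ)}ᶜ) (nhds c) ∧
      (∀ δ > 0, ∀ ε > 0, ∃ C : ℝ, ∀ σ t : ℝ, α + δ ≤ σ → 1 ≤ |t| →
        ‖F (σ + t * Complex.I)‖ ≤ C * |t| ^ ((1:ℝ) + ε)) := by
  obtain ⟨hα0, hα1⟩ := hα
  have hb1 : ∀ n, 1 ≤ b n := fun n => hb0.trans (hb.monotone (Nat.zero_le n))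
  have hE : ∀ ε > 0, ∃ K : ℝ, 0 ≤ K ∧ ∀ x : ℝ, 1 ≤ x → ‖Asum b a x - c * x‖ ≤ K * x ^ (α + ε) :=
    fun ε hε => E_bound hb hbtop a c _ (by linarith) (hA ε hε)
  have hM : ∀ s : ℂ, α < s.re → DifferentiableAt ℂ (fun s => mellin (Eg b a c) (-s)) s := by
    intro s hs
    obtain ⟨K, hK, h⟩ := hE ((s.re - α) / 2) (by linarith)
    have h1 : DifferentiableAt ℂ (mellin (Eg b a c)) (-s) :=
      mellin_differentiableAt_of_isBigO_rpow (a := -(α + (s.re - α) / 2)) (b := (-s).re - 1)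
        (Eg_locInt hb hbtop a c (by linarith) hK h) (Eg_top hK h) (by simp; linarith)
        (Eg_zero b a c _) (by linarith)
    exact DifferentiableAt.comp (g := mellin (Eg b a c)) (f := fun z : ℂ => -z) s h1 differentiableAt_id.neg
  refine ⟨fun s => c * s / (s - 1) + s * mellin (Eg b a c) (-s), ?_, ?_, ?_, ?_⟩
  · rintro s ⟨hs, hs1⟩
    have hs1' : s - 1 ≠ 0 := sub_ne_zero.2 hs1
    refine DifferentiableAt.differentiableWithinAt ?_
    refine DifferentiableAt.add ?_ (differentiableAt_id.mul (hM s hs))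
    exact DifferentiableAt.div (by fun_prop) (by fun_prop) hs1'
  · intro s hs
    obtain ⟨K, hK, h⟩ := hE ((1 - α) / 2) (by linarith)
    exact series_tendsto hb hb1 hbtop a c (by linarith) hK h hs
  · have hc : ContinuousAt (fun s => c * s + (s - 1) * (s * mellin (Eg b a c) (-s))) (1:ℂ) := by
      have := (hM 1 (by simpa using hα1)).continuousAt
      exact (continuousAt_const.mul continuousAt_id).add
        ((continuousAt_id.sub continuousAt_const).mul (continuousAt_id.mul this))
    have h2 := hc.tendsto.mono_left (nhdsWithin_le_nhds (s := {(1:ℂ)}ᶜ))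
    simp only [mul_one, sub_self, zero_mul, add_zero] at h2
    refine h2.congr' ?_
    filter_upwards [self_mem_nhdsWithin] with s hs
    have hs1' : s - 1 ≠ 0 := sub_ne_zero.2 hs
    field_simp
  · intro δ hδ ε hε
    obtain ⟨K, hK, h⟩ := hE (δ / 2) (by linarith)
    refine ⟨2 * ‖c‖ + K * (2 * (α + δ) / δ + 2 / δ), fun σ t hσ ht => ?_⟩
    set s : ℂ := σ + t * Complex.I with hsdef
    have hre : s.re = σ := by simp [hsdef]
    have him : s.im = t := by simp [hsdef]
    have ht0 : 0 < |t| := by linarith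
    have hσ0 : 0 < σ := by linarith
    have hs1n : |t| ≤ ‖s - 1‖ := by
      have := Complex.abs_im_le_norm (s - 1)
      simpa [him] using this
    have hs1p : 0 < ‖s - 1‖ := by linarith
    have hsn : ‖s‖ ≤ σ + |t| := by
      have := Complex.norm_le_abs_re_add_abs_im s
      rwa [hre, him, abs_of_pos hσ0] at this
    have hsn1 : ‖s‖ ≤ 2 * ‖s - 1‖ := by
      have := norm_add_le (s - 1) 1
      rw [sub_add_cancel, norm_one] at this
      linarith
    have hm := mellin_bound hK h (s := s) (by rw [hre]; linarith)
    rw [hre] at hm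
    have hd : 0 < σ - (α + δ / 2) := by linarith
    have hfirst : ‖c * s / (s - 1)‖ ≤ 2 * ‖c‖ := by
      rw [norm_div, norm_mul, div_le_iff₀ hs1p]
      nlinarith [norm_nonneg c]
    have hq : (σ + |t|) / (σ - (α + δ / 2)) ≤ (2 * (α + δ) / δ + 2 / δ) * |t| := by
      rw [div_le_iff₀ hd]
      have e1 : (2 * (α + δ) / δ + 2 / δ) * |t| * (σ - (α + δ / 2)) =
        (2 * (σ - (α + δ / 2)) / δ) * ((α + δ) * |t| + |t|) := by ring
      rw [e1]
      have h5 : 1 + 2 * (σ - (α + δ)) / δ = 2 * (σ - (α + δ / 2)) / δ := by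
        field_simp; ring
      rw [← h5]
      have h6 : σ - (α + δ) = δ * ((σ - (α + δ)) / δ) := by field_simp
      set u := (σ - (α + δ)) / δ with hu
      have hu0 : 0 ≤ u := div_nonneg (by linarith) hδ.le
      have h7 : 2 * (σ - (α + δ)) / δ = 2 * u := by rw [hu]; ring
      rw [h7]
      have h8 : σ = α + δ + δ * u := by linarith
      rw [h8]
      have h9 : (α + δ) ≤ (α + δ) * |t| := by nlinarith
      nlinarith [mul_nonneg hu0 ht0.le, mul_nonneg hu0 hα0, mul_nonneg hu0 hδ.le,
        mul_le_mul_of_nonneg_left h9 hu0]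
    have hsecond : ‖s * mellin (Eg b a c) (-s)‖ ≤ K * (2 * (α + δ) / δ + 2 / δ) * |t| := by
      rw [norm_mul]
      calc _ ≤ (σ + |t|) * (K / (σ - (α + δ / 2))) := by gcongr
        _ = K * ((σ + |t|) / (σ - (α + δ / 2))) := by ring
        _ ≤ K * ((2 * (α + δ) / δ + 2 / δ) * |t|) := by gcongr
        _ = _ := by ring
    have ht1 : |t| ≤ |t| ^ ((1:ℝ) + ε) := by
      simpa using Real.rpow_le_rpow_of_exponent_le ht (by linarith : (1:ℝ) ≤ 1 + ε)
    have hC : 0 ≤ 2 * ‖c‖ + K * (2 * (α + δ) / δ + 2 / δ) := by positivity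
    calc _ ≤ 2 * ‖c‖ + K * (2 * (α + δ) / δ + 2 / δ) * |t| :=
          (norm_add_le _ _).trans (add_le_add hfirst hsecond)
      _ ≤ (2 * ‖c‖ + K * (2 * (α + δ) / δ + 2 / δ)) * |t| := by nlinarith [norm_nonneg c]
      _ ≤ _ := by gcongr
end
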